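/- arXiv:math/0112186 — 3 statements merged into one kernel-verified Lean document; each statement's English description precedes it below -/
import Mathlib

section
/- Let J ⊆ S = 𝕜[x_{1,1},…,x_{1,n_1},…,x_{k,1},…,x_{k,n_k}] be a monomial ideal, and let I ⊆ R be the ideal generated by the lifts m̄ of the minimal monomial generators m of J, where for a monomial m = ∏_{i,j} x_{i,j}^{a_{i,j}} the lift is m̄ = ∏_{i=1}^{k} ∏_{j=1}^{n_i} ∏_{l=1}^{a_{i,j}} (x_{i,j} − (l−1)x_{i,0}). Then I is a lifting of J to R; that is: (i) I is a radical ideal of R, (ii) (I, x_{1,0},…,x_{k,0})/(x_{1,0},…,x_{k,0}) ≅ J, and (iii) x_{1,0},…,x_{k,0} give rise to a regular sequence in R/I. -/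
open MvPolynomial

noncomputable section

namespace PaperMP

variable (K : Type) [Field K] [IsAlgClosed K] [CharZero K]
variable (k : ℕ) (n : Fin k → ℕ)

/-- Index type of the variables `x_{i,j}`, `1 ≤ i ≤ k`, `0 ≤ j ≤ n i`. -/
abbrev Sig := Σ i : Fin k, Fin (n i + 1)

/-- The `ℕ^k`-graded polynomial ring `R`. -/
abbrev MPRing := MvPolynomial (Sig k n) K

/-- The grading of `R`: `deg x_{i,j} = e_i`. -/
def wt : Sig k n → (Fin k → ℕ) := fun p => Pi.single p.1 1

/-- A point of `ℙ^{n_1} × ⋯ × ℙ^{n_k}`. -/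
abbrev MPPoint := ∀ i : Fin k, Projectivization K (Fin (n i + 1) → K)

/-- The affine cone over a point of multiprojective space. -/
def cone (P : MPPoint K k n) : Set (Sig k n → K) :=
  {x | ∀ i : Fin k, ∃ c : K, (fun j => x ⟨i, j⟩) = c • (P i).rep}

/-- Vanishing ideal of a set of points of affine space. -/
def vanishingIdeal (T : Set (Sig k n → K)) : Ideal (MPRing K k n) :=
  ⨅ x ∈ T, RingHom.ker (MvPolynomial.eval x)

/-- The (prime) ideal `I_P` of a point of multiprojective space. -/
def idealOfPoint (P : MPPoint K k n) : Ideal (MPRing K k n) :=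
  vanishingIdeal K k n (cone K k n P)

/-- The ideal `I_X` of a set of points of multiprojective space. -/
def idealOfSet (X : Set (MPPoint K k n)) : Ideal (MPRing K k n) :=
  ⨅ P ∈ X, idealOfPoint K k n P

/-- The Hilbert function of `R/I` in multidegree `d`. -/
def hilb (I : Ideal (MPRing K k n)) (d : Fin k → ℕ) : ℕ :=
  Module.finrank K ((weightedHomogeneousSubmodule K (wt k n) d).map
    (Ideal.Quotient.mkₐ K I).toLinearMap)

/-- The irrelevant maximal ideal `m = (x_{1,0},…,x_{k,n_k})`. -/
def maxIdeal : Ideal (MPRing K k n) :=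
  Ideal.span (Set.range (MvPolynomial.X : Sig k n → MPRing K k n))

/-- `L` is a regular sequence modulo `I`:  `(I,L) ⊆ m`, and each entry is a
non-zero divisor modulo `I` together with the previous entries. -/
def IsRegSeqMod (I : Ideal (MPRing K k n)) (L : List (MPRing K k n)) : Prop :=
  I ⊔ Ideal.span {f | f ∈ L} ≤ maxIdeal K k n ∧
  ∀ i : Fin L.length, ∀ G : MPRing K k n,
    L.get i * G ∈ I ⊔ Ideal.span {f | f ∈ L.take i} →
      G ∈ I ⊔ Ideal.span {f | f ∈ L.take i}

/-- `depth R/I = l`: `l` is the length of a maximal regular sequence modulo `I`. -/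
def hasDepth (I : Ideal (MPRing K k n)) (l : ℕ) : Prop :=
  IsGreatest {r : ℕ | ∃ L : List (MPRing K k n), L.length = r ∧ IsRegSeqMod K k n I L} l

/-- `X` is arithmetically Cohen–Macaulay: `depth R/I_X = K-dim R/I_X = k`. -/
def IsACM (X : Set (MPPoint K k n)) : Prop :=
  hasDepth K k n (idealOfSet K k n X) k

/-! ### The first difference function -/

/-- Extend `H : ℕ^k → ℕ` by zero outside ℕ^k. -/
def extNeg (H : (Fin k → ℕ) → ℕ) (j : Fin k → ℤ) : ℤ :=
  if ∀ i, 0 ≤ j i then H (fun i => (j i).toNat) else 0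

/-- The first difference function `ΔH` of a numerical function `H : ℕ^k → ℕ`. -/
def delta (H : (Fin k → ℕ) → ℕ) (d : Fin k → ℕ) : ℤ :=
  ∑ l : Fin k → Fin 2, (-1 : ℤ) ^ (∑ i, (l i : ℕ)) *
    extNeg k H (fun i => (d i : ℤ) - (l i : ℕ))

/-! ### The ring `S = k[x_{1,1},…,x_{k,n_k}]` -/

/-- Index type of the variables `x_{i,j}`, `1 ≤ i ≤ k`, `1 ≤ j ≤ n i`. -/
abbrev SigS := Σ i : Fin k, Fin (n i)

/-- The `ℕ^k`-graded polynomial ring `S`. -/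
abbrev SRing := MvPolynomial (SigS k n) K

/-- The grading of `S`: `deg x_{i,j} = e_i`. -/
def wtS : SigS k n → (Fin k → ℕ) := fun p => Pi.single p.1 1

/-- The Hilbert function of `S/J` in multidegree `d`. -/
def hilbS (J : Ideal (SRing K k n)) (d : Fin k → ℕ) : ℕ :=
  Module.finrank K ((weightedHomogeneousSubmodule K (wtS k n) d).map
    (Ideal.Quotient.mkₐ K J).toLinearMap)

/-- `J` is an `ℕ^k`-homogeneous ideal of `S`. -/
def IsHomogIdealS (J : Ideal (SRing K k n)) : Prop :=
  ∀ f ∈ J, ∀ d : Fin k → ℕ, weightedHomogeneousComponent (wtS k n) d f ∈ J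

/-- `J` is an artinian ideal of `S`: `√J = (x_{1,1},…,x_{k,n_k})`. -/
def IsArtinianIdealS (J : Ideal (SRing K k n)) : Prop :=
  J.radical = Ideal.span (Set.range (MvPolynomial.X : SigS k n → SRing K k n))

/-! ### The ring `k[x_1,…,x_k]`, with `deg x_i = e_i` -/

abbrev TRing := MvPolynomial (Fin k) K

/-- The grading: `deg x_i = e_i`. -/
def wtT : Fin k → (Fin k → ℕ) := fun i => Pi.single i 1

/-- The Hilbert function of `k[x_1,…,x_k]/I` in multidegree `d`. -/
def hilbT (I : Ideal (TRing K k)) (d : Fin k → ℕ) : ℕ :=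
  Module.finrank K ((weightedHomogeneousSubmodule K (wtT k) d).map
    (Ideal.Quotient.mkₐ K I).toLinearMap)

/-- `I` is an `ℕ^k`-homogeneous ideal of `k[x_1,…,x_k]`. -/
def IsHomogIdealT (I : Ideal (TRing K k)) : Prop :=
  ∀ f ∈ I, ∀ d : Fin k → ℕ, weightedHomogeneousComponent (wtT k) d f ∈ I

/-- `I` is an artinian ideal of `k[x_1,…,x_k]`: `√I = (x_1,…,x_k)`. -/
def IsArtinianIdealT (I : Ideal (TRing K k)) : Prop :=
  I.radical = Ideal.span (Set.range (MvPolynomial.X : Fin k → TRing K k))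

/-! ### Lifting monomial ideals -/

/-- The lift `m̄ = ∏_{i,j} ∏_{l=1}^{a_{i,j}} (x_{i,j} - (l-1) x_{i,0})` of the monomial
of `S` with exponent vector `b`, via the lifting matrix `𝒜`. -/
def liftMonomial (b : SigS k n →₀ ℕ) : MPRing K k n :=
  ∏ p ∈ b.support, ∏ l ∈ Finset.range (b p),
    (MvPolynomial.X (⟨p.1, p.2.succ⟩ : Sig k n) - (l : MPRing K k n) * MvPolynomial.X ⟨p.1, 0⟩)

/-- `J` is a monomial ideal of `S`. -/
def IsMonomialIdeal (J : Ideal (SRing K k n)) : Prop :=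
  ∃ A : Set (SigS k n →₀ ℕ), J = Ideal.span ((fun b => (monomial b (1 : K) : SRing K k n)) '' A)

/-- The exponent vectors of the minimal monomial generators of a monomial ideal `J ⊆ S`. -/
def minGens (J : Ideal (SRing K k n)) : Set (SigS k n →₀ ℕ) :=
  {b | (monomial b (1 : K) : SRing K k n) ∈ J ∧
    ∀ b' : SigS k n →₀ ℕ, b' ≤ b → b' ≠ b → (monomial b' (1 : K) : SRing K k n) ∉ J}

/-- The lift to `R` of a monomial ideal `J ⊆ S`, generated by the lifts of the
minimal monomial generators of `J`. -/
def liftIdeal (J : Ideal (SRing K k n)) : Ideal (MPRing K k n) :=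
  Ideal.span (liftMonomial K k n '' minGens K k n J)

/-- The projection `R → S ≅ R/(x_{1,0},…,x_{k,0})` sending `x_{i,0} ↦ 0` and
`x_{i,j} ↦ x_{i,j}` for `j ≥ 1`. -/
def projToS : MPRing K k n →ₐ[K] SRing K k n :=
  aeval (fun p : Sig k n =>
    if h : p.2 = 0 then 0 else MvPolynomial.X (⟨p.1, p.2.pred h⟩ : SigS k n))

/-- The point `[1:b_{i,1}:⋯:b_{i,n_i}] × ⋯` of multiprojective space associated to the
exponent vector `b` of a monomial of `S`. -/
def monToPoint (b : SigS k n →₀ ℕ) : MPPoint K k n := fun i =>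
  Projectivization.mk K
    (fun j : Fin (n i + 1) => if h : j = 0 then 1 else ((b ⟨i, j.pred h⟩ : ℕ) : K))
    (fun hc => by simpa using congrFun hc 0)

/-! ### Partitions -/

/-- `lam` is a partition: positive non-increasing entries. -/
def IsPartition {t : ℕ} (lam : Fin t → ℕ) : Prop :=
  (∀ j, 0 < lam j) ∧ Antitone lam

/-- `lam` is a partition of `s`. -/
def IsPartitionOf (s : ℕ) {t : ℕ} (lam : Fin t → ℕ) : Prop :=
  IsPartition lam ∧ ∑ j, lam j = s

/-- The `(i+1)`-st entry `λ*_{i+1} = #{j : λ_j ≥ i+1}` of the conjugate partition. -/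
def conjEntry {t : ℕ} (lam : Fin t → ℕ) (i : ℕ) : ℕ :=
  (Finset.univ.filter fun j : Fin t => i + 1 ≤ lam j).card

/-- `β` is the conjugate partition `α*` of `α`. -/
def IsConjugateOf {t m : ℕ} (α : Fin t → ℕ) (β : Fin m → ℕ) : Prop :=
  (∀ i : Fin m, β i = conjEntry α i) ∧ ∀ i : ℕ, m ≤ i → conjEntry α i = 0

/-! ### `ℙ^1 × ℙ^1` -/

/-- A point of `ℙ^1`. -/
abbrev Proj1 := Projectivization K (Fin 2 → K)

/-- A point of `ℙ^1 × ℙ^1`. -/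
abbrev Pt2 := MPPoint K 2 (fun _ => 1)

/-- The coordinate ring of `ℙ^1 × ℙ^1`. -/
abbrev R2 := MPRing K 2 (fun _ => 1)

/-- `P` enumerates the distinct first coordinates of `X` and `α` lists the sizes of the
corresponding fibers, in non-increasing order; so `α = α_X`. -/
def IsAlphaLabel (X : Set (Pt2 K)) {t : ℕ} (P : Fin t → Proj1 K) (α : Fin t → ℕ) : Prop :=
  Function.Injective P ∧ (Set.range P = (fun Z : Pt2 K => Z 0) '' X) ∧
  (∀ i, α i = Set.ncard {Z | Z ∈ X ∧ Z 0 = P i}) ∧ Antitone α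

/-- `Q` enumerates the distinct second coordinates of `X` and `β` lists the sizes of the
corresponding fibers, in non-increasing order; so `β = β_X`. -/
def IsBetaLabel (X : Set (Pt2 K)) {r : ℕ} (Q : Fin r → Proj1 K) (β : Fin r → ℕ) : Prop :=
  Function.Injective Q ∧ (Set.range Q = (fun Z : Pt2 K => Z 1) '' X) ∧
  (∀ i, β i = Set.ncard {Z | Z ∈ X ∧ Z 1 = Q i}) ∧ Antitone β

/-- `α = α_X`. -/
def IsAlphaPartition (X : Set (Pt2 K)) {t : ℕ} (α : Fin t → ℕ) : Prop :=
  ∃ P : Fin t → Proj1 K, IsAlphaLabel K X P α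

/-- `β = β_X`. -/
def IsBetaPartition (X : Set (Pt2 K)) {r : ℕ} (β : Fin r → ℕ) : Prop :=
  ∃ Q : Fin r → Proj1 K, IsBetaLabel K X Q β

/-- `F` is "the" form of degree `(1,0)` vanishing at all points of `ℙ^1 × ℙ^1` whose
first coordinate is `P`. -/
def IsForm1Of (P : Proj1 K) (F : R2 K) : Prop :=
  IsWeightedHomogeneous (wt 2 (fun _ => 1)) F (Pi.single 0 1) ∧ F ≠ 0 ∧
  ∀ x : Sig 2 (fun _ => 1) → K,
    (∃ c : K, (fun j : Fin 2 => x ⟨0, j⟩) = c • P.rep) → MvPolynomial.eval x F = 0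

/-- `F` is "the" form of degree `(0,1)` vanishing at all points of `ℙ^1 × ℙ^1` whose
second coordinate is `P`. -/
def IsForm2Of (P : Proj1 K) (F : R2 K) : Prop :=
  IsWeightedHomogeneous (wt 2 (fun _ => 1)) F (Pi.single 1 1) ∧ F ≠ 0 ∧
  ∀ x : Sig 2 (fun _ => 1) → K,
    (∃ c : K, (fun j : Fin 2 => x ⟨1, j⟩) = c • P.rep) → MvPolynomial.eval x F = 0

end PaperMP

namespace PaperMP

section Lifting

variable {K : Type} [Field K] {k : ℕ} {n : Fin k → ℕ}

lemma liftMonomial_eq_prod (b : SigS k n →₀ ℕ) :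
    liftMonomial K k n b = ∏ p, ∏ l ∈ Finset.range (b p),
      (X (⟨p.1, p.2.succ⟩ : Sig k n) - (l : MPRing K k n) * X ⟨p.1, 0⟩) := by
  refine Finset.prod_subset (Finset.subset_univ _) fun p _ hp => ?_
  rw [Finsupp.notMem_support_iff.mp hp]
  simp

lemma liftMonomial_dvd {b c : SigS k n →₀ ℕ} (h : b ≤ c) :
    liftMonomial K k n b ∣ liftMonomial K k n c := by
  rw [liftMonomial_eq_prod, liftMonomial_eq_prod]
  refine Finset.prod_dvd_prod_of_dvd _ _ fun p _ => ?_
  exact Finset.prod_dvd_prod_of_subset _ _ _ (Finset.range_subset_range.mpr (h p))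

lemma liftMonomial_zero : liftMonomial K k n 0 = 1 := by
  simp [liftMonomial]

lemma liftMonomial_add_single (b : SigS k n →₀ ℕ) (p : SigS k n) :
    liftMonomial K k n (b + Finsupp.single p 1) = liftMonomial K k n b *
      (X (⟨p.1, p.2.succ⟩ : Sig k n) - (b p : MPRing K k n) * X ⟨p.1, 0⟩) := by
  classical
  rw [liftMonomial_eq_prod, liftMonomial_eq_prod]
  have h : ∀ q : SigS k n, ∏ l ∈ Finset.range ((b + Finsupp.single p 1 : SigS k n →₀ ℕ) q),
      (X (⟨q.1, q.2.succ⟩ : Sig k n) - (l : MPRing K k n) * X ⟨q.1, 0⟩) =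
      (∏ l ∈ Finset.range (b q),
        (X (⟨q.1, q.2.succ⟩ : Sig k n) - (l : MPRing K k n) * X ⟨q.1, 0⟩)) *
      (if q = p then (X (⟨p.1, p.2.succ⟩ : Sig k n) - (b p : MPRing K k n) * X ⟨p.1, 0⟩)
        else 1) := by
    intro q
    by_cases hq : q = p
    · subst hq
      simp [Finset.prod_range_succ]
    · simp [hq]
  rw [Finset.prod_congr rfl fun q _ => h q, Finset.prod_mul_distrib]
  simp

lemma projToS_liftMonomial (b : SigS k n →₀ ℕ) :
    projToS K k n (liftMonomial K k n b) = monomial b 1 := by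
  have h : ∀ p : SigS k n, ∀ l : ℕ, projToS K k n
      (X (⟨p.1, p.2.succ⟩ : Sig k n) - (l : MPRing K k n) * X ⟨p.1, 0⟩) = X p := by
    intro p l
    simp [projToS]
  rw [liftMonomial, map_prod, monomial_eq, Finsupp.prod]
  simp only [map_prod, h, Finset.prod_const, Finset.card_range, C_1, one_mul]

variable (K n) in
/-- The inclusion of `K[x_{1,0},…,x_{k,0}]` into `R`. -/
def baseIncl : TRing K k →ₐ[K] MPRing K k n :=
  rename fun i => ⟨i, 0⟩

variable (K) in
/-- The evaluation `R → K[x_{1,0},…,x_{k,0}]` sending `x_{i,j}` to `b_{i,j} x_{i,0}`. -/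
def evalAt (b : SigS k n →₀ ℕ) : MPRing K k n →ₐ[K] TRing K k :=
  aeval fun p : Sig k n =>
    if h : p.2 = 0 then X p.1 else (b ⟨p.1, p.2.pred h⟩ : TRing K k) * X p.1

lemma evalAt_baseIncl (b : SigS k n →₀ ℕ) (f : TRing K k) :
    evalAt K b (baseIncl K n f) = f := by
  have : (evalAt K b).comp (baseIncl K n) = AlgHom.id K _ := by
    ext i : 1
    simp [evalAt, baseIncl]
  exact DFunLike.congr_fun this f

lemma evalAt_liftMonomial (b c : SigS k n →₀ ℕ) :
    evalAt K b (liftMonomial K k n c) = ∏ p, ∏ l ∈ Finset.range (c p),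
      (((b p : TRing K k) - (l : TRing K k)) * X p.1) := by
  rw [liftMonomial_eq_prod]
  simp only [map_prod, sub_mul]
  simp [evalAt]

lemma evalAt_liftMonomial_eq_zero {b c : SigS k n →₀ ℕ} (h : ¬ c ≤ b) :
    evalAt K b (liftMonomial K k n c) = 0 := by
  rw [evalAt_liftMonomial]
  obtain ⟨p, hp⟩ : ∃ p, b p < c p := by
    simpa [Finsupp.le_def] using h
  refine Finset.prod_eq_zero (Finset.mem_univ p) ?_
  exact Finset.prod_eq_zero (Finset.mem_range.mpr hp) (by simp)

lemma evalAt_liftMonomial_self_ne_zero [CharZero K] (b : SigS k n →₀ ℕ) :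
    evalAt K b (liftMonomial K k n b) ≠ 0 := by
  rw [evalAt_liftMonomial]
  refine Finset.prod_ne_zero_iff.mpr fun p _ => Finset.prod_ne_zero_iff.mpr fun l hl => ?_
  refine mul_ne_zero (sub_ne_zero.mpr ?_) (X_ne_zero _)
  exact_mod_cast (Finset.mem_range.mp hl).ne'

variable (K n) in
/-- Linear combinations of the lifted monomials with coefficients in `K[x_{1,0},…,x_{k,0}]`. -/
def liftComb : ((SigS k n →₀ ℕ) →₀ TRing K k) →+ MPRing K k n :=
  Finsupp.liftAddHom fun b =>
    (AddMonoidHom.mulRight (liftMonomial K k n b)).comp (baseIncl K n : TRing K k →+ MPRing K k n)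

lemma liftComb_apply (a : (SigS k n →₀ ℕ) →₀ TRing K k) :
    liftComb K n a = ∑ b ∈ a.support, baseIncl K n (a b) * liftMonomial K k n b := rfl

lemma liftComb_single (b : SigS k n →₀ ℕ) (f : TRing K k) :
    liftComb K n (Finsupp.single b f) = baseIncl K n f * liftMonomial K k n b := by
  simp [liftComb]

lemma liftComb_smul (f : TRing K k) (a : (SigS k n →₀ ℕ) →₀ TRing K k) :
    liftComb K n (f • a) = baseIncl K n f * liftComb K n a := by
  induction a using Finsupp.induction_linear with
  | zero => simp
  | add a b ha hb => rw [smul_add, map_add, map_add, ha, hb, mul_add]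
  | single b g =>
    rw [Finsupp.smul_single, smul_eq_mul, liftComb_single, liftComb_single, map_mul, mul_assoc]

lemma exists_liftComb_eq_mul_X (a : (SigS k n →₀ ℕ) →₀ TRing K k) (p : Sig k n) :
    ∃ c, liftComb K n c = liftComb K n a * X p := by
  obtain ⟨i, j⟩ := p
  induction j using Fin.cases with
  | zero => exact ⟨X i • a, by rw [liftComb_smul, mul_comm]; simp [baseIncl]⟩
  | succ j =>
    induction a using Finsupp.induction_linear with
    | zero => exact ⟨0, by simp⟩
    | add a b ha hb =>
      obtain ⟨c, hc⟩ := ha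
      obtain ⟨d, hd⟩ := hb
      exact ⟨c + d, by rw [map_add, map_add, hc, hd, add_mul]⟩
    | single b f =>
      refine ⟨Finsupp.single (b + Finsupp.single ⟨i, j⟩ 1) f +
        Finsupp.single b (f * ((b ⟨i, j⟩ : TRing K k) * X i)), ?_⟩
      rw [map_add, liftComb_single, liftComb_single, liftComb_single, liftMonomial_add_single]
      simp only [map_mul, map_natCast]
      simp only [baseIncl, rename_X]
      ring

lemma liftComb_surjective : Function.Surjective (liftComb K n) := by
  intro f
  induction f using MvPolynomial.induction_on with
  | C r => exact ⟨Finsupp.single 0 (C r), by simp [liftComb_single, liftMonomial_zero, baseIncl]⟩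
  | add f g hf hg =>
    obtain ⟨a, rfl⟩ := hf
    obtain ⟨b, rfl⟩ := hg
    exact ⟨a + b, map_add _ _ _⟩
  | mul_X f p hf =>
    obtain ⟨a, rfl⟩ := hf
    exact exists_liftComb_eq_mul_X a p

variable {J : Ideal (SRing K k n)}

lemma monomial_mem_of_le {b c : SigS k n →₀ ℕ} (h : b ≤ c)
    (hb : (monomial b (1 : K) : SRing K k n) ∈ J) : (monomial c (1 : K) : SRing K k n) ∈ J := by
  have : (monomial c (1 : K) : SRing K k n) = monomial (c - b) 1 * monomial b 1 := by
    rw [monomial_mul, tsub_add_cancel_of_le h, one_mul]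
  rw [this]
  exact J.mul_mem_left _ hb

lemma exists_minGens_le {b : SigS k n →₀ ℕ} (hb : (monomial b (1 : K) : SRing K k n) ∈ J) :
    ∃ c ∈ minGens K k n J, c ≤ b := by
  induction b using WellFoundedLT.induction with
  | ind b ih =>
    by_cases h : b ∈ minGens K k n J
    · exact ⟨b, h, le_rfl⟩
    · obtain ⟨c, hcb, hne, hc⟩ : ∃ c, c ≤ b ∧ c ≠ b ∧ (monomial c (1 : K) : SRing K k n) ∈ J := by
        by_contra! hcon
        exact h ⟨hb, hcon⟩
      obtain ⟨d, hd, hdc⟩ := ih c (lt_of_le_of_ne hcb hne) hc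
      exact ⟨d, hd, hdc.trans hcb⟩

lemma liftMonomial_mem_liftIdeal {b : SigS k n →₀ ℕ}
    (hb : (monomial b (1 : K) : SRing K k n) ∈ J) :
    liftMonomial K k n b ∈ liftIdeal K k n J := by
  obtain ⟨c, hc, hcb⟩ := exists_minGens_le hb
  exact Ideal.mem_of_dvd _ (liftMonomial_dvd hcb) (Ideal.subset_span ⟨c, hc, rfl⟩)

lemma evalAt_eq_zero_of_mem_liftIdeal {b : SigS k n →₀ ℕ}
    (hb : (monomial b (1 : K) : SRing K k n) ∉ J) {f : MPRing K k n}
    (hf : f ∈ liftIdeal K k n J) : evalAt K b f = 0 := by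
  suffices h : liftIdeal K k n J ≤ RingHom.ker (evalAt K b) from h hf
  refine Ideal.span_le.mpr ?_
  rintro _ ⟨c, hc, rfl⟩
  exact evalAt_liftMonomial_eq_zero fun hcb => hb (monomial_mem_of_le hcb hc.1)

lemma coeff_eq_zero_of_evalAt_eq_zero [CharZero K] {a : (SigS k n →₀ ℕ) →₀ TRing K k}
    (h : ∀ b, (monomial b (1 : K) : SRing K k n) ∉ J → evalAt K b (liftComb K n a) = 0)
    (b : SigS k n →₀ ℕ) (hb : (monomial b (1 : K) : SRing K k n) ∉ J) : a b = 0 := by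
  induction b using WellFoundedLT.induction with
  | ind b ih =>
    have hsum := h b hb
    rw [liftComb_apply, map_sum] at hsum
    by_contra hab
    rw [Finset.sum_eq_single b] at hsum
    · rw [map_mul, evalAt_baseIncl] at hsum
      exact mul_ne_zero hab (evalAt_liftMonomial_self_ne_zero b) hsum
    · intro c hc hcb
      by_cases hle : c ≤ b
      · have := ih c (lt_of_le_of_ne hle hcb) fun hcJ => hb (monomial_mem_of_le hle hcJ)
        rw [this, map_zero, zero_mul, map_zero]
      · rw [map_mul, evalAt_liftMonomial_eq_zero hle, mul_zero]
    · intro hbs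
      exact absurd (Finsupp.notMem_support_iff.mp hbs) hab

lemma liftComb_mem_sup (P : Ideal (TRing K k)) {a : (SigS k n →₀ ℕ) →₀ TRing K k}
    (h : ∀ b, (monomial b (1 : K) : SRing K k n) ∉ J → a b ∈ P) :
    liftComb K n a ∈ liftIdeal K k n J ⊔ P.map (baseIncl K n) := by
  rw [liftComb_apply]
  refine Ideal.sum_mem _ fun b _ => ?_
  by_cases hb : (monomial b (1 : K) : SRing K k n) ∈ J
  · exact Ideal.mul_mem_left _ _ (Ideal.mem_sup_left (liftMonomial_mem_liftIdeal hb))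
  · exact Ideal.mul_mem_right _ _ (Ideal.mem_sup_right (Ideal.mem_map_of_mem _ (h b hb)))

/-- The lift of a monomial ideal is an intersection of kernels of evaluations. -/
lemma mem_liftIdeal_iff [CharZero K] {f : MPRing K k n} :
    f ∈ liftIdeal K k n J ↔
      ∀ b, (monomial b (1 : K) : SRing K k n) ∉ J → evalAt K b f = 0 := by
  refine ⟨fun hf b hb => evalAt_eq_zero_of_mem_liftIdeal hb hf, fun h => ?_⟩
  obtain ⟨a, rfl⟩ := liftComb_surjective f
  have := liftComb_mem_sup (J := J) (⊥ : Ideal (TRing K k)) (a := a) fun b hb =>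
    (Submodule.mem_bot _).mpr (coeff_eq_zero_of_evalAt_eq_zero h b hb)
  rwa [Ideal.map_bot, sup_bot_eq] at this

lemma exists_liftComb_of_mem_map (P : Ideal (TRing K k)) {f : MPRing K k n}
    (hf : f ∈ P.map (baseIncl K n)) : ∃ a, liftComb K n a = f ∧ ∀ b, a b ∈ P := by
  suffices h : ∀ r : MPRing K k n, ∃ a, liftComb K n a = r * f ∧ ∀ b, a b ∈ P by
    simpa using h 1
  refine Submodule.span_induction
    (p := fun f _ => ∀ r : MPRing K k n, ∃ a, liftComb K n a = r * f ∧ ∀ b, a b ∈ P)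
    ?_ ?_ ?_ ?_ hf
  · rintro _ ⟨x, hx, rfl⟩ r
    obtain ⟨d, rfl⟩ := liftComb_surjective r
    exact ⟨x • d, by rw [liftComb_smul, mul_comm], fun b => P.mul_mem_right _ hx⟩
  · exact fun r => ⟨0, by simp, fun b => P.zero_mem⟩
  · intro x y _ _ hx hy r
    obtain ⟨a, ha, haP⟩ := hx r
    obtain ⟨c, hc, hcP⟩ := hy r
    exact ⟨a + c, by rw [map_add, ha, hc, mul_add], fun b => P.add_mem (haP b) (hcP b)⟩
  · intro s x _ hx r
    obtain ⟨a, ha, haP⟩ := hx (r * s)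
    exact ⟨a, by rw [ha, smul_eq_mul, mul_assoc], haP⟩

/-- `R/I` is free over `K[x_{1,0},…,x_{k,0}]` with basis the lifts of the monomials outside `J`,
so membership in `I + PR` can be tested on coefficients. -/
lemma liftComb_mem_sup_iff [CharZero K] (P : Ideal (TRing K k))
    {a : (SigS k n →₀ ℕ) →₀ TRing K k} :
    liftComb K n a ∈ liftIdeal K k n J ⊔ P.map (baseIncl K n) ↔
      ∀ b, (monomial b (1 : K) : SRing K k n) ∉ J → a b ∈ P := by
  refine ⟨fun h b hb => ?_, liftComb_mem_sup P⟩
  obtain ⟨u, hu, v, hv, huv⟩ := Submodule.mem_sup.mp h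
  obtain ⟨c, rfl, hc⟩ := exists_liftComb_of_mem_map P hv
  have hac : liftComb K n (a - c) = u := by rw [map_sub, ← huv, add_sub_cancel_right]
  have := coeff_eq_zero_of_evalAt_eq_zero (a := a - c)
    (fun b hb => hac ▸ evalAt_eq_zero_of_mem_liftIdeal hb hu) b hb
  rw [Finsupp.sub_apply, sub_eq_zero] at this
  exact this ▸ hc b

lemma mem_span_X_image_of_X_mul_mem {T : Set (Fin k)} {i : Fin k} (hi : i ∉ T) {f : TRing K k}
    (h : X i * f ∈ Ideal.span (X '' T : Set (TRing K k))) :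
    f ∈ Ideal.span (X '' T : Set (TRing K k)) := by
  rw [mem_ideal_span_X_image] at h ⊢
  intro m hm
  obtain ⟨j, hj, hmj⟩ := h (Finsupp.single i 1 + m) (by
    rw [mem_support_iff, coeff_X_mul]
    exact mem_support_iff.mp hm)
  have hij : i ≠ j := fun hij => hi (hij ▸ hj)
  exact ⟨j, hj, by simpa [Finsupp.single_apply, hij] using hmj⟩

lemma mem_sup_of_X_mul_mem [CharZero K] {T : Set (Fin k)} {i : Fin k} (hi : i ∉ T)
    {G : MPRing K k n}
    (h : X (⟨i, 0⟩ : Sig k n) * G ∈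
      liftIdeal K k n J ⊔ Ideal.span ((fun j => X (⟨j, 0⟩ : Sig k n)) '' T)) :
    G ∈ liftIdeal K k n J ⊔ Ideal.span ((fun j => X (⟨j, 0⟩ : Sig k n)) '' T) := by
  have hmap : Ideal.span ((fun j => X (⟨j, 0⟩ : Sig k n)) '' T) =
      (Ideal.span (X '' T : Set (TRing K k))).map (baseIncl K n) := by
    rw [Ideal.map_span, Set.image_image]
    simp [baseIncl]
  rw [hmap] at h ⊢
  obtain ⟨a, rfl⟩ := liftComb_surjective G
  have hX : (X (⟨i, 0⟩ : Sig k n) : MPRing K k n) = baseIncl K n (X i) := by simp [baseIncl]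
  rw [hX, ← liftComb_smul, liftComb_mem_sup_iff] at h
  rw [liftComb_mem_sup_iff]
  exact fun b hb => mem_span_X_image_of_X_mul_mem hi (h b hb)

lemma isRadical_liftIdeal [CharZero K] : (liftIdeal K k n J).IsRadical := by
  rintro f ⟨m, hm⟩
  rw [mem_liftIdeal_iff] at hm ⊢
  intro b hb
  have := hm b hb
  rw [map_pow] at this
  exact eq_zero_of_pow_eq_zero this

lemma map_projToS_liftIdeal (hJ : IsMonomialIdeal K k n J) :
    (liftIdeal K k n J).map (projToS K k n) = J := by
  have hmem : ∀ b, (monomial b (1 : K) : SRing K k n) ∈ J →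
      (monomial b (1 : K) : SRing K k n) ∈ (liftIdeal K k n J).map (projToS K k n) :=
    fun b hb => projToS_liftMonomial (K := K) b ▸
      Ideal.mem_map_of_mem _ (liftMonomial_mem_liftIdeal hb)
  apply le_antisymm
  · rw [liftIdeal, Ideal.map_span, Ideal.span_le]
    rintro _ ⟨_, ⟨b, hb, rfl⟩, rfl⟩
    simpa [projToS_liftMonomial] using hb.1
  · obtain ⟨A, hA⟩ := hJ
    conv_lhs => rw [hA]
    rw [Ideal.span_le]
    rintro _ ⟨b, hb, rfl⟩
    exact hmem b (hA ▸ Ideal.subset_span ⟨b, hb, rfl⟩)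

lemma liftIdeal_le_maxIdeal (hJ : J ≠ ⊤) : liftIdeal K k n J ≤ maxIdeal K k n := by
  refine Ideal.span_le.mpr ?_
  rintro _ ⟨b, hb, rfl⟩
  have hb0 : b ≠ 0 := by
    rintro rfl
    exact hJ ((Ideal.eq_top_iff_one _).mpr hb.1)
  obtain ⟨p, hp⟩ := Finsupp.ne_iff.mp hb0
  have hX : ∀ q : Sig k n, (X q : MPRing K k n) ∈ maxIdeal K k n :=
    fun q => Ideal.subset_span ⟨q, rfl⟩
  rw [SetLike.mem_coe, liftMonomial, ← Finset.mul_prod_erase _ _ (Finsupp.mem_support_iff.mpr hp)]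
  refine Ideal.mul_mem_right _ _ ?_
  rw [← Finset.mul_prod_erase _ _ (Finset.mem_range.mpr (Nat.pos_of_ne_zero hp))]
  exact Ideal.mul_mem_right _ _ (Ideal.sub_mem _ (hX _) (Ideal.mul_mem_left _ _ (hX _)))

lemma isRegSeqMod_liftIdeal [CharZero K] (hJ : J ≠ ⊤) :
    IsRegSeqMod K k n (liftIdeal K k n J)
      (List.ofFn fun i : Fin k => X (⟨i, 0⟩ : Sig k n)) := by
  refine ⟨sup_le (liftIdeal_le_maxIdeal hJ) (Ideal.span_mono ?_), fun i G hG => ?_⟩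
  · intro f hf
    obtain ⟨i, rfl⟩ := List.mem_ofFn.mp hf
    exact ⟨_, rfl⟩
  · have hik : (i : ℕ) < k := by simpa using i.2
    have hset : {f | f ∈ (List.ofFn fun j : Fin k =>
        (X (⟨j, 0⟩ : Sig k n) : MPRing K k n)).take i} =
        (fun j => X (⟨j, 0⟩ : Sig k n)) '' {j : Fin k | (j : ℕ) < i} := by
      ext f
      simp only [Set.mem_ofPred_eq, Set.mem_image, List.mem_take_iff_getElem, List.getElem_ofFn,
        List.length_ofFn]
      constructor
      · rintro ⟨j, hj, rfl⟩
        exact ⟨⟨j, by omega⟩, by simp; omega, rfl⟩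
      · rintro ⟨j, hj, rfl⟩
        exact ⟨j, by omega, rfl⟩
    rw [hset] at hG ⊢
    rw [List.get_ofFn] at hG
    exact mem_sup_of_X_mul_mem (i := ⟨i, hik⟩) (by simp) hG

end Lifting

/-- the lift (via the lifting matrix `𝒜`) of a monomial ideal `J ⊆ S`
is a lifting of `J` to `R`: it is radical, it maps onto `J` modulo
`(x_{1,0},…,x_{k,0})`, and `x_{1,0},…,x_{k,0}` is a regular sequence modulo it. -/
theorem statement_5 (K : Type) [Field K] [IsAlgClosed K] [CharZero K]
    (k : ℕ) (n : Fin k → ℕ)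
    (J : Ideal (SRing K k n)) (hJmon : IsMonomialIdeal K k n J) (hJne : J ≠ ⊤)
    (I : Ideal (MPRing K k n)) (hI : I = liftIdeal K k n J) :
    I.radical = I ∧
    Ideal.map (projToS K k n) I = J ∧
    IsRegSeqMod K k n I
      (List.ofFn fun i : Fin k => MvPolynomial.X (⟨i, 0⟩ : Sig k n)) := by
  subst hI
  exact ⟨isRadical_liftIdeal.radical, map_projToS_liftIdeal hJmon, isRegSeqMod_liftIdeal hJne⟩

end PaperMP
end
end

section
/- Let H : ℕ^k → ℕ be a numerical function. Then H is the Hilbert function of an ACM set of distinct points in ℙ^{n_1} × ⋯ × ℙ^{n_k} if and only if the first difference function ΔH(i_1,…,i_k) = Σ_{0 ≤ (l_1,…,l_k) ≤ (1,…,1)} (−1)^{l_1+⋯+l_k} H(i_1−l_1,…,i_k−l_k) (with H(j) = 0 whenever j has a negative coordinate) is the Hilbert function of some ℕ^k-graded artinian quotient of S = 𝕜[x_{1,1},…,x_{1,n_1},…,x_{k,1},…,x_{k,n_k}]. -/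
open MvPolynomial

noncomputable section

namespace PaperMP

/-! ### Regular elements modulo an ideal and depth of cyclic modules -/

section LocalAlgebra

variable {A : Type*} [CommRing A]

/-- `x` is a non-zero-divisor on `A ⧸ I`. -/
def NonZeroDivMod (I : Ideal A) (x : A) : Prop := ∀ g, x * g ∈ I → g ∈ I

lemma NonZeroDivMod.swap {I : Ideal A} {x z : A} (hx : NonZeroDivMod I x)
    (hz : NonZeroDivMod (I ⊔ Ideal.span {x}) z) :
    NonZeroDivMod (I ⊔ Ideal.span {z}) x := by
  intro g hg
  obtain ⟨i, hi, w, hw, hiw⟩ := Submodule.mem_sup.1 hg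
  obtain ⟨h, rfl⟩ := Ideal.mem_span_singleton'.1 hw
  have h1 : z * h ∈ I ⊔ Ideal.span {x} := by
    have : z * h = x * g + -i := by rw [← hiw]; ring
    rw [this]
    exact add_mem (Ideal.mem_sup_right (Ideal.mem_span_singleton'.2 ⟨g, mul_comm _ _⟩))
      (Ideal.mem_sup_left (neg_mem hi))
  obtain ⟨i', hi', w', hw', hiw'⟩ := Submodule.mem_sup.1 (hz _ h1)
  obtain ⟨h', rfl⟩ := Ideal.mem_span_singleton'.1 hw'
  have h2 : g - h' * z ∈ I := by
    apply hx
    have : x * (g - h' * z) = i + i' * z := by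
      have e : x * g = i + h * z := hiw.symm
      rw [mul_sub, e, ← hiw']; ring
    rw [this]
    exact add_mem hi (Ideal.mul_mem_right _ _ hi')
  have : g = (g - h' * z) + h' * z := by ring
  rw [this]
  exact add_mem (Ideal.mem_sup_left h2)
    (Ideal.mem_sup_right (Ideal.mem_span_singleton'.2 ⟨h', rfl⟩))

lemma mem_associatedPrimes_quotient [IsNoetherianRing A] {I p : Ideal A} :
    p ∈ associatedPrimes A (A ⧸ I) ↔ p.IsPrime ∧ ∃ g, ∀ y, y ∈ p ↔ y * g ∈ I := by
  rw [AssociatedPrimes.mem_iff, isAssociatedPrime_iff]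
  refine and_congr_right fun _ => ⟨?_, ?_⟩
  · rintro ⟨x, rfl⟩
    obtain ⟨g, rfl⟩ := Ideal.Quotient.mk_surjective x
    refine ⟨g, fun y => ?_⟩
    rw [Submodule.mem_colon_singleton, Submodule.mem_bot, Algebra.smul_def,
      Ideal.Quotient.algebraMap_eq, ← map_mul, Ideal.Quotient.eq_zero_iff_mem]
  · rintro ⟨g, hg⟩
    refine ⟨Ideal.Quotient.mk I g, ?_⟩
    ext y
    rw [hg, Submodule.mem_colon_singleton, Submodule.mem_bot, Algebra.smul_def,
      Ideal.Quotient.algebraMap_eq, ← map_mul, Ideal.Quotient.eq_zero_iff_mem]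

lemma exists_mem_associatedPrimes_quotient [IsNoetherianRing A] {I : Ideal A} {g : A}
    (hg : g ∉ I) : ∃ p ∈ associatedPrimes A (A ⧸ I), ∀ y, y * g ∈ I → y ∈ p := by
  obtain ⟨p, hp, hle⟩ := exists_le_isAssociatedPrime_of_isNoetherianRing A
    (Ideal.Quotient.mk I g) (by rwa [Ne, Ideal.Quotient.eq_zero_iff_mem])
  refine ⟨p, hp, fun y hy => hle ?_⟩
  rwa [Submodule.mem_colon_singleton, Submodule.mem_bot, Algebra.smul_def,
      Ideal.Quotient.algebraMap_eq, ← map_mul, Ideal.Quotient.eq_zero_iff_mem]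

lemma nonZeroDivMod_of_forall_notMem [IsNoetherianRing A] {I : Ideal A} {x : A}
    (h : ∀ p ∈ associatedPrimes A (A ⧸ I), x ∉ p) : NonZeroDivMod I x := by
  intro g hg
  by_contra hgI
  obtain ⟨p, hp, hle⟩ := exists_mem_associatedPrimes_quotient hgI
  exact h p hp (hle x hg)

lemma NonZeroDivMod.notMem [IsNoetherianRing A] {I p : Ideal A} {x : A}
    (h : NonZeroDivMod I x) (hp : p ∈ associatedPrimes A (A ⧸ I)) : x ∉ p := by
  obtain ⟨hpr, g, hg⟩ := mem_associatedPrimes_quotient.1 hp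
  intro hx
  refine hpr.ne_top ((Ideal.eq_top_iff_one p).2 ((hg 1).2 ?_))
  rw [one_mul]
  exact h g ((hg x).1 hx)

variable [IsLocalRing A]

open IsLocalRing

/-- `A ⧸ I` admits a (weakly) regular sequence of length `r` in the maximal ideal. -/
def DepthGE : ℕ → Ideal A → Prop
  | 0, _ => True
  | r + 1, I => ∃ x ∈ maximalIdeal A, NonZeroDivMod I x ∧ DepthGE r (I ⊔ Ideal.span {x})

variable [IsNoetherianRing A]

lemma exists_nonZeroDivMod_three {I₁ I₂ I₃ : Ideal A}
    (h₁ : maximalIdeal A ∉ associatedPrimes A (A ⧸ I₁))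
    (h₂ : maximalIdeal A ∉ associatedPrimes A (A ⧸ I₂))
    (h₃ : maximalIdeal A ∉ associatedPrimes A (A ⧸ I₃)) :
    ∃ z ∈ maximalIdeal A, NonZeroDivMod I₁ z ∧ NonZeroDivMod I₂ z ∧ NonZeroDivMod I₃ z := by
  set S := associatedPrimes A (A ⧸ I₁) ∪ associatedPrimes A (A ⧸ I₂) ∪
    associatedPrimes A (A ⧸ I₃) with hS
  have hfin : S.Finite := ((associatedPrimes.finite A _).union (associatedPrimes.finite A _)).union
    (associatedPrimes.finite A _)
  have hprime : ∀ p ∈ S, p.IsPrime := by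
    rintro p ((hp | hp) | hp) <;> exact hp.1
  have hnot : ¬ ((maximalIdeal A : Set A) ⊆ ⋃ p ∈ S, (p : Set A)) := by
    intro h
    obtain ⟨p, hp, hle⟩ := (Ideal.subset_union_prime_finite hfin (f := id) ⊥ ⊥
      (fun p hp _ _ => hprime p hp)).1 h
    have : p = maximalIdeal A :=
      le_antisymm (le_maximalIdeal (hprime p hp).ne_top) hle
    subst this
    rcases hp with (hp | hp) | hp <;> contradiction
  obtain ⟨z, hz, hzn⟩ := Set.not_subset.1 hnot
  simp only [Set.mem_iUnion, not_exists] at hzn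
  exact ⟨z, hz, nonZeroDivMod_of_forall_notMem fun p hp => hzn p (.inl (.inl hp)),
    nonZeroDivMod_of_forall_notMem fun p hp => hzn p (.inl (.inr hp)),
    nonZeroDivMod_of_forall_notMem fun p hp => hzn p (.inr hp)⟩

/-- If `x` and `y` are regular modulo `I` and the maximal ideal is not associated to `I + (y)`,
then it is not associated to `I + (x)`. -/
lemma maximalIdeal_notMem_associatedPrimes {I : Ideal A} {x y : A}
    (hxI : NonZeroDivMod I x) (hy : y ∈ maximalIdeal A) (hyI : NonZeroDivMod I y)
    (h : maximalIdeal A ∉ associatedPrimes A (A ⧸ (I ⊔ Ideal.span {y}))) :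
    maximalIdeal A ∉ associatedPrimes A (A ⧸ (I ⊔ Ideal.span {x})) := by
  intro hm
  apply h
  obtain ⟨hpr, u, hu⟩ := mem_associatedPrimes_quotient.1 hm
  have huI : u ∉ I ⊔ Ideal.span {x} := fun hc =>
    hpr.ne_top ((Ideal.eq_top_iff_one _).2 ((hu 1).2 (by rwa [one_mul])))
  obtain ⟨i, hi, w, hw, hiw⟩ := Submodule.mem_sup.1 ((hu y).1 hy)
  obtain ⟨v, rfl⟩ := Ideal.mem_span_singleton'.1 hw
  have hvI : v ∉ I ⊔ Ideal.span {y} := by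
    intro hv
    obtain ⟨i', hi', w', hw', hiw'⟩ := Submodule.mem_sup.1 hv
    obtain ⟨t, rfl⟩ := Ideal.mem_span_singleton'.1 hw'
    apply huI
    have : u - t * x ∈ I := by
      apply hyI
      have : y * (u - t * x) = i + i' * x := by rw [mul_sub, ← hiw, ← hiw']; ring
      rw [this]
      exact add_mem hi (Ideal.mul_mem_right _ _ hi')
    have e : u = (u - t * x) + t * x := by ring
    rw [e]
    exact add_mem (Ideal.mem_sup_left this)
      (Ideal.mem_sup_right (Ideal.mem_span_singleton'.2 ⟨t, rfl⟩))
  have hmv : ∀ a ∈ maximalIdeal A, a * v ∈ I ⊔ Ideal.span {y} := by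
    intro a ha
    obtain ⟨j, hj, w', hw', hjw⟩ := Submodule.mem_sup.1 ((hu a).1 ha)
    obtain ⟨t, rfl⟩ := Ideal.mem_span_singleton'.1 hw'
    have : a * v - t * y ∈ I := by
      apply hxI
      have : x * (a * v - t * y) = y * j - a * i := by
        have e1 : v * x = y * u - i := by rw [← hiw]; ring
        have e2 : t * x = a * u - j := by rw [← hjw]; ring
        calc x * (a * v - t * y) = a * (v * x) - y * (t * x) := by ring
          _ = y * j - a * i := by rw [e1, e2]; ring
      rw [this]
      exact sub_mem (Ideal.mul_mem_left _ _ hj) (Ideal.mul_mem_left _ _ hi)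
    have e : a * v = (a * v - t * y) + t * y := by ring
    rw [e]
    exact add_mem (Ideal.mem_sup_left this)
      (Ideal.mem_sup_right (Ideal.mem_span_singleton'.2 ⟨t, rfl⟩))
  refine mem_associatedPrimes_quotient.2 ⟨hpr, v, fun a => ⟨hmv a, fun ha => ?_⟩⟩
  by_contra hau
  have hunit : IsUnit a := by simpa [mem_maximalIdeal] using hau
  obtain ⟨b, hb⟩ := hunit.exists_left_inv
  apply hvI
  have : v = b * (a * v) := by rw [← mul_assoc, hb, one_mul]
  rw [this]
  exact Ideal.mul_mem_left _ _ ha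

lemma DepthGE.maximalIdeal_notMem {r : ℕ} {I : Ideal A} (h : DepthGE (r + 1) I) :
    maximalIdeal A ∉ associatedPrimes A (A ⧸ I) := by
  obtain ⟨x, hx, hxI, -⟩ := h
  exact fun hm => hxI.notMem hm hx

/-- Dividing by a regular element of the maximal ideal lowers the depth by at most one. -/
lemma DepthGE.sup_span_singleton {r : ℕ} {I : Ideal A} {x : A} (h : DepthGE (r + 1) I)
    (hx : x ∈ maximalIdeal A) (hxI : NonZeroDivMod I x) :
    DepthGE r (I ⊔ Ideal.span {x}) := by
  induction r generalizing I x with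
  | zero => trivial
  | succ r ih =>
    have hI := h.maximalIdeal_notMem
    obtain ⟨y, hy, hyI, hD⟩ := h
    have hIy := hD.maximalIdeal_notMem
    obtain ⟨z, hz, -, hzx, hzy⟩ := exists_nonZeroDivMod_three hI
      (maximalIdeal_notMem_associatedPrimes hxI hy hyI hIy) hIy
    have hDz : DepthGE (r + 1) (I ⊔ Ideal.span {z}) := by
      refine ⟨y, hy, hyI.swap hzy, ?_⟩
      have := ih hD hz hzy
      rwa [sup_right_comm] at this
    refine ⟨z, hz, hzx, ?_⟩
    have := ih hDz hx (hxI.swap hzx)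
    rwa [sup_right_comm] at this

/-- The dimension of every associated prime is bounded below by the depth. -/
lemma DepthGE.le_ringKrullDim {r : ℕ} {I p : Ideal A} (h : DepthGE r I)
    (hp : p ∈ associatedPrimes A (A ⧸ I)) : (r : WithBot ℕ∞) ≤ ringKrullDim (A ⧸ p) := by
  induction r generalizing I p with
  | zero =>
    have := hp.1
    simpa using ringKrullDim_nonneg_of_nontrivial (R := A ⧸ p)
  | succ r ih =>
    obtain ⟨x, hx, hxI, hD⟩ := h
    have hxp := hxI.notMem hp
    obtain ⟨hpr, g, hg⟩ := mem_associatedPrimes_quotient.1 hp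
    obtain ⟨u, hu, huI⟩ : ∃ u, (∀ y ∈ p, y * u ∈ I) ∧ u ∉ I ⊔ Ideal.span {x} := by
      by_contra! hcon
      let N : Ideal A :=
        { carrier := {u | ∀ y ∈ p, y * u ∈ I}
          add_mem' := fun {a b} ha hb y hy => by
            rw [mul_add]; exact add_mem (ha y hy) (hb y hy)
          zero_mem' := fun y _ => by simp
          smul_mem' := fun c a ha y hy => by
            rw [smul_eq_mul, mul_left_comm]; exact Ideal.mul_mem_left _ _ (ha y hy) }
      have hle : N ≤ I ⊔ Ideal.span {x} • N := by
        intro u hu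
        obtain ⟨i, hi, w, hw, hiw⟩ := Submodule.mem_sup.1 (hcon u hu)
        obtain ⟨t, rfl⟩ := Ideal.mem_span_singleton'.1 hw
        rw [← hiw]
        refine add_mem (Ideal.mem_sup_left hi) (Ideal.mem_sup_right ?_)
        rw [smul_eq_mul, mul_comm]
        refine Ideal.mul_mem_mul ?_ (Ideal.mem_span_singleton_self x)
        intro y hy
        apply hxI
        have : x * (y * t) = y * u - y * i := by rw [← hiw]; ring
        rw [this]
        exact sub_mem (hu y hy) (Ideal.mul_mem_left _ _ hi)
      have hNI : N ≤ I := Submodule.le_of_le_smul_of_le_jacobson_bot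
        (IsNoetherian.noetherian N) (by
          rw [jacobson_eq_maximalIdeal _ bot_ne_top, Ideal.span_le]
          simpa using hx) hle
      have hgI : g ∈ I := hNI fun y hy => (hg y).1 hy
      exact hpr.ne_top ((Ideal.eq_top_iff_one p).2 ((hg 1).2 (by rwa [one_mul])))
    obtain ⟨q, hq, hqle⟩ := exists_mem_associatedPrimes_quotient huI
    have hpq : p ≤ q := fun y hy => hqle y (Ideal.mem_sup_left (hu y hy))
    have hxq : x ∈ q := hqle x (Ideal.mem_sup_right
      (Ideal.mem_span_singleton'.2 ⟨u, mul_comm _ _⟩))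
    have := ringKrullDim_succ_le_of_surjective (Ideal.Quotient.factor hpq)
      (Ideal.Quotient.factor_surjective hpq) (r := Ideal.Quotient.mk p x)
      (by
        have := hpr
        rw [mem_nonZeroDivisors_iff_ne_zero, Ne, Ideal.Quotient.eq_zero_iff_mem]
        exact hxp)
      (by simpa [Ideal.Quotient.eq_zero_iff_mem] using hxq)
    refine le_trans ?_ this
    push_cast
    gcongr
    exact ih hD hq

/-- If finitely many elements generate, together with the prime `p`, an ideal whose radical is the
maximal ideal, then their number bounds the dimension of `A ⧸ p`. -/
lemma ringKrullDim_quotient_le_card {p : Ideal A} [hp : p.IsPrime] {s : Finset A}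
    (hs : (s : Set A) ⊆ maximalIdeal A)
    (hrad : maximalIdeal A ≤ (p ⊔ Ideal.span (s : Set A)).radical) :
    ringKrullDim (A ⧸ p) ≤ s.card := by
  classical
  let π := Ideal.Quotient.mk p
  have hloc : IsLocalHom π := IsLocalHom.of_surjective _ Ideal.Quotient.mk_surjective
  have : IsLocalRing (A ⧸ p) := IsLocalRing.of_surjective' π Ideal.Quotient.mk_surjective
  have hmem : ∀ a ∈ maximalIdeal A, π a ∈ maximalIdeal (A ⧸ p) := fun a ha =>
    map_nonunit π a ha
  have h0 : ringKrullDim ((A ⧸ p) ⧸ Ideal.span ((s.image π : Finset (A ⧸ p)) : Set (A ⧸ p)))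
      ≤ 0 := by
    have : Ring.KrullDimLE 0
        ((A ⧸ p) ⧸ Ideal.span ((s.image π : Finset (A ⧸ p)) : Set (A ⧸ p))) := by
      apply Ring.KrullDimLE.mk₀
      intro Q hQ
      set ψ : A →+* _ := (Ideal.Quotient.mk
        (Ideal.span ((s.image π : Finset (A ⧸ p)) : Set (A ⧸ p)))).comp π with hψ
      have hsurj : Function.Surjective ψ :=
        Ideal.Quotient.mk_surjective.comp Ideal.Quotient.mk_surjective
      have hle : p ⊔ Ideal.span (s : Set A) ≤ Q.comap ψ := by
        refine sup_le (fun a ha => ?_) (Ideal.span_le.2 fun a ha => ?_)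
        · have : π a = 0 := Ideal.Quotient.eq_zero_iff_mem.2 ha
          simp [hψ, this]
        · have : ψ a = 0 := by
            rw [hψ, RingHom.comp_apply, Ideal.Quotient.eq_zero_iff_mem]
            exact Ideal.subset_span (by simpa using ⟨a, ha, rfl⟩)
          simp [this]
      have hpr : (Q.comap ψ).IsPrime := Ideal.comap_isPrime ψ Q
      have hmax : maximalIdeal A ≤ Q.comap ψ :=
        hrad.trans ((Ideal.radical_mono hle).trans hpr.radical.le)
      have he : Q.comap ψ = maximalIdeal A :=
        le_antisymm (le_maximalIdeal hpr.ne_top) hmax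
      have hmx : (Q.comap ψ).IsMaximal := he ▸ maximalIdeal.isMaximal A
      rw [← Ideal.map_comap_of_surjective ψ hsurj Q]
      refine (Ideal.map_eq_top_or_isMaximal_of_surjective ψ hsurj hmx).resolve_left ?_
      rw [Ideal.map_comap_of_surjective ψ hsurj Q]
      exact hQ.ne_top
    simpa using Ring.krullDimLE_iff.1 this
  have h1 := ringKrullDim_le_ringKrullDim_quotient_add_card (s.image π) (by
    rw [ringJacobson_eq_maximalIdeal]
    intro a ha
    obtain ⟨b, hb, rfl⟩ := Finset.mem_image.1 ha
    exact hmem b (hs hb))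
  calc ringKrullDim (A ⧸ p) ≤ _ := h1
    _ ≤ 0 + (s.image π).card := by gcongr
    _ ≤ s.card := by
      rw [zero_add]
      exact_mod_cast Finset.card_image_le

/-- The depth of `A ⧸ I` is at most the length of any system of parameters. -/
lemma DepthGE.le_card {ι : Type*} {r : ℕ} {I : Ideal A} (hD : DepthGE r I) (hI : I ≠ ⊤)
    {L : ι → A} {s : Finset ι} (hL : ∀ i ∈ s, L i ∈ maximalIdeal A)
    (hrad : maximalIdeal A ≤ (I ⊔ Ideal.span (L '' s)).radical) : r ≤ s.card := by
  classical
  obtain ⟨p, hp, hpI⟩ := exists_mem_associatedPrimes_quotient (g := (1 : A))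
    ((Ideal.ne_top_iff_one I).1 hI)
  have := hp.1
  have hIp : I ≤ p := fun y hy => hpI y (by simpa using hy)
  have h1 := hD.le_ringKrullDim hp
  have h2 := ringKrullDim_quotient_le_card (p := p) (s := s.image L)
    (by intro a ha; obtain ⟨i, hi, rfl⟩ := Finset.mem_image.1 ha; exact hL i hi)
    (hrad.trans (Ideal.radical_mono (by rw [Finset.coe_image]; exact sup_le_sup_right hIp _)))
  have h3 : (r : WithBot ℕ∞) ≤ ((s.image L).card : WithBot ℕ∞) := h1.trans h2
  exact le_trans (by exact_mod_cast h3) Finset.card_image_le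

/-- In a Cohen–Macaulay situation every system of parameters starts with a regular element. -/
lemma DepthGE.nonZeroDivMod {ι : Type*} {I : Ideal A} {L : ι → A} {s : Finset ι}
    (hD : DepthGE s.card I) (hL : ∀ i ∈ s, L i ∈ maximalIdeal A)
    (hrad : maximalIdeal A ≤ (I ⊔ Ideal.span (L '' s)).radical) {i : ι} (hi : i ∈ s) :
    NonZeroDivMod I (L i) := by
  classical
  refine nonZeroDivMod_of_forall_notMem fun p hp hip => ?_
  obtain ⟨hpr, g, hg⟩ := mem_associatedPrimes_quotient.1 hp
  have hIp : I ≤ p := fun y hy => (hg y).2 (Ideal.mul_mem_right _ _ hy)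
  have h1 := hD.le_ringKrullDim hp
  have h2 := ringKrullDim_quotient_le_card (p := p) (s := (s.erase i).image L)
    (by
      intro a ha
      obtain ⟨j, hj, rfl⟩ := Finset.mem_image.1 ha
      exact hL j (Finset.mem_of_mem_erase hj))
    (hrad.trans (Ideal.radical_mono (by
      refine sup_le (hIp.trans le_sup_left) (Ideal.span_le.2 ?_)
      rintro _ ⟨j, hj, rfl⟩
      by_cases hji : j = i
      · subst hji; exact Ideal.mem_sup_left hip
      · exact Ideal.mem_sup_right (Ideal.subset_span
          (by simpa using ⟨j, ⟨hj, hji⟩, rfl⟩)))))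
  have h3 : (s.card : WithBot ℕ∞) ≤ (((s.erase i).image L).card : WithBot ℕ∞) := h1.trans h2
  have h4 : s.card ≤ (s.erase i).card :=
    le_trans (by exact_mod_cast h3) Finset.card_image_le
  exact absurd (Finset.card_erase_lt_of_mem hi) (not_lt.2 h4)

/-- In a Cohen–Macaulay situation every system of parameters is regular in any order. -/
lemma DepthGE.nonZeroDivMod_sup {ι : Type*} {I : Ideal A} {L : ι → A} {s t : Finset ι}
    (hD : DepthGE s.card I) (hL : ∀ i ∈ s, L i ∈ maximalIdeal A)
    (hrad : maximalIdeal A ≤ (I ⊔ Ideal.span (L '' s)).radical) (hts : t ⊆ s) {i : ι}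
    (hi : i ∈ s) (hit : i ∉ t) : NonZeroDivMod (I ⊔ Ideal.span (L '' t)) (L i) := by
  classical
  suffices key : ∀ t ⊆ s, DepthGE (s \ t).card (I ⊔ Ideal.span (L '' t)) ∧
      ∀ i ∈ s \ t, NonZeroDivMod (I ⊔ Ideal.span (L '' t)) (L i) from
    (key t hts).2 i (Finset.mem_sdiff.2 ⟨hi, hit⟩)
  have hstep : ∀ t ⊆ s, DepthGE (s \ t).card (I ⊔ Ideal.span (L '' t)) →
      ∀ i ∈ s \ t, NonZeroDivMod (I ⊔ Ideal.span (L '' t)) (L i) := by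
    intro t ht hDt i hi
    refine hDt.nonZeroDivMod (fun j hj => hL j (Finset.mem_sdiff.1 hj).1)
      (hrad.trans (Ideal.radical_mono ?_)) hi
    rw [sup_assoc, ← Ideal.span_union, ← Set.image_union]
    refine sup_le_sup_left (Ideal.span_mono (Set.image_mono ?_)) _
    intro j hj
    by_cases hjt : j ∈ t <;> simp_all
  intro t
  induction t using Finset.induction_on with
  | empty => exact fun h => ⟨by simpa using hD, hstep ∅ h (by simpa using hD)⟩
  | insert a t ha ih =>
    intro hat
    have hts : t ⊆ s := (Finset.subset_insert _ _).trans hat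
    have has : a ∈ s := hat (Finset.mem_insert_self _ _)
    obtain ⟨hDt, hreg⟩ := ih hts
    have hcard : (s \ t).card = (s \ insert a t).card + 1 := by
      rw [Finset.sdiff_insert, Finset.card_erase_add_one]
      exact Finset.mem_sdiff.2 ⟨has, ha⟩
    rw [hcard] at hDt
    have := hDt.sup_span_singleton (hL a has) (hreg a (Finset.mem_sdiff.2 ⟨has, ha⟩))
    rw [sup_assoc, ← Ideal.span_union, Set.union_singleton, ← Set.image_insert_eq,
      ← Finset.coe_insert] at this
    exact ⟨this, hstep _ hat this⟩

end LocalAlgebra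

/-! ### Multigraded ideals of polynomial rings -/

section Graded

variable {σ K κ : Type*} [Field K]

/-- Homogeneous ideals for the grading of a polynomial ring given by a weight. -/
def HomogIdeal (w : σ → κ → ℕ) (I : Ideal (MvPolynomial σ K)) : Prop :=
  ∀ f ∈ I, ∀ d, weightedHomogeneousComponent w d f ∈ I

/-- The Hilbert function of a quotient of a polynomial ring graded by a weight. -/
def ghilb (w : σ → κ → ℕ) (I : Ideal (MvPolynomial σ K)) (d : κ → ℕ) : ℕ :=
  Module.finrank K ((weightedHomogeneousSubmodule K w d).map
    (Ideal.Quotient.mkₐ K I).toLinearMap)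

lemma weightedHomogeneousComponent_mul_of_mem {w : σ → κ → ℕ} {e : κ → ℕ}
    {l : MvPolynomial σ K} (hl : IsWeightedHomogeneous w l e) (g : MvPolynomial σ K)
    (d : κ → ℕ) [Decidable (e ≤ d)] :
    weightedHomogeneousComponent w d (l * g) =
      if e ≤ d then l * weightedHomogeneousComponent w (d - e) g else 0 := by
  classical
  let := weightedGradedAlgebra K w
  have := DirectSum.coe_decompose_mul_of_left_mem (weightedHomogeneousSubmodule K w) (b := g) d
    (i := e) (a := l) hl
  simp_rw [← weightedDecomposition.decompose'_apply]
  exact this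

lemma homogIdeal_iff [DecidableEq (κ → ℕ)] {w : σ → κ → ℕ} {I : Ideal (MvPolynomial σ K)} :
    letI := weightedGradedAlgebra K w
    HomogIdeal w I ↔ I.IsHomogeneous (weightedHomogeneousSubmodule K w) := by
  constructor
  · intro h d f hf
    have := h f hf d
    rw [← weightedDecomposition.decompose'_apply] at this
    exact this
  · intro h f hf d
    exact weightedHomogeneousComponent_mem_of_mem K w h hf d

lemma HomogIdeal.sup {w : σ → κ → ℕ} {I I' : Ideal (MvPolynomial σ K)} (h : HomogIdeal w I)
    (h' : HomogIdeal w I') : HomogIdeal w (I ⊔ I') := by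
  classical
  rw [homogIdeal_iff] at *
  let := weightedGradedAlgebra K w
  exact h.sup h'

lemma HomogIdeal.span {w : σ → κ → ℕ} {s : Set (MvPolynomial σ K)}
    (h : ∀ l ∈ s, ∃ e, IsWeightedHomogeneous w l e) : HomogIdeal w (Ideal.span s) := by
  classical
  rw [homogIdeal_iff]
  let := weightedGradedAlgebra K w
  exact Ideal.homogeneous_span _ _ h

lemma HomogIdeal.mem_of_forall {w : σ → κ → ℕ} {I : Ideal (MvPolynomial σ K)}
    {f : MvPolynomial σ K} (h : ∀ d, weightedHomogeneousComponent w d f ∈ I) : f ∈ I := by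
  rw [← sum_weightedHomogeneousComponent w f,
    finsum_eq_sum _ (weightedHomogeneousComponent_finsupp f)]
  exact Ideal.sum_mem _ fun d _ => h d

lemma idealOfVars_eq_ker : idealOfVars σ K = RingHom.ker (constantCoeff (σ := σ) (R := K)) := by
  ext f
  have := mem_pow_idealOfVars_iff' 1 f
  rw [pow_one] at this
  simp [this, RingHom.mem_ker, constantCoeff_eq, Finsupp.degree_eq_zero_iff]

instance isMaximal_idealOfVars : (idealOfVars σ K).IsMaximal := by
  rw [idealOfVars_eq_ker]
  exact RingHom.ker_isMaximal_of_surjective _ fun c => ⟨C c, constantCoeff_C _ _⟩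

variable [Fintype κ]

lemma sum_weight_apply {w : σ → κ → ℕ} (hw : ∀ p, ∑ i, w p i = 1) (e : σ →₀ ℕ) :
    ∑ i, Finsupp.weight w e i = Finsupp.degree e := by
  induction e using Finsupp.induction_linear with
  | zero => simp
  | add f g hf hg => simp [Finset.sum_add_distrib, hf, hg]
  | single a b => simp [Finsupp.weight_single, ← Finset.mul_sum, hw]

lemma HomogIdeal.mem_of_mul_mem {w : σ → κ → ℕ} (hw : ∀ p, ∑ i, w p i = 1)
    {I : Ideal (MvPolynomial σ K)} (hI : HomogIdeal w I) {t G : MvPolynomial σ K}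
    (ht : t ∉ idealOfVars σ K) (h : t * G ∈ I) : G ∈ I := by
  have ht0 : constantCoeff t ≠ 0 := by rwa [idealOfVars_eq_ker, RingHom.mem_ker] at ht
  set u := 1 - C (constantCoeff t)⁻¹ * t with hu
  have hum : u ∈ idealOfVars σ K := by
    rw [idealOfVars_eq_ker, RingHom.mem_ker]
    simp [hu, ht0]
  refine HomogIdeal.mem_of_forall (w := w) fun d => ?_
  set N := ∑ i, d i + 1
  have h1 : G - u ^ N * G ∈ I := by
    obtain ⟨v, hv⟩ := one_sub_dvd_one_sub_pow u N
    have : G - u ^ N * G = v * C (constantCoeff t)⁻¹ * (t * G) := by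
      calc G - u ^ N * G = (1 - u ^ N) * G := by ring
        _ = _ := by rw [hv, hu]; ring
    rw [this]
    exact Ideal.mul_mem_left _ _ h
  have h2 : weightedHomogeneousComponent w d (u ^ N * G) = 0 := by
    classical
    ext e
    rw [coeff_weightedHomogeneousComponent]
    split_ifs with he
    · have : u ^ N * G ∈ idealOfVars σ K ^ N := Ideal.mul_mem_right _ _ (Ideal.pow_mem_pow hum _)
      rw [mem_pow_idealOfVars_iff'] at this
      rw [this e, coeff_zero]
      rw [← sum_weight_apply hw, he]
      exact Nat.lt_succ_self _
    · simp
  simpa [h2] using hI _ h1 d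

/-! ### Localization at the irrelevant ideal -/

lemma NonZeroDivMod.map_localization {A : Type*} [CommRing A] {m : Ideal A} [m.IsPrime]
    {I : Ideal A} {x : A}
    (h : NonZeroDivMod I x) :
    NonZeroDivMod (I.map (algebraMap A (Localization.AtPrime m)))
      (algebraMap A (Localization.AtPrime m) x) := by
  intro g hg
  obtain ⟨⟨a, s⟩, rfl⟩ := IsLocalization.mk'_surjective m.primeCompl g
  rw [← IsLocalization.mk'_one (M := m.primeCompl), ← IsLocalization.mk'_mul,
    IsLocalization.mk'_mem_map_algebraMap_iff] at hg
  rw [IsLocalization.mk'_mem_map_algebraMap_iff]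
  obtain ⟨t, ht, htg⟩ := hg
  exact ⟨t, ht, h _ (by rwa [mul_left_comm])⟩

lemma depthGE_of_isRegular {A : Type*} [CommRing A] {m : Ideal A} [m.IsPrime] (L : List A)
    {I : Ideal A}
    (hm : ∀ x ∈ L, x ∈ m)
    (h : ∀ i : Fin L.length, NonZeroDivMod (I ⊔ Ideal.span {f | f ∈ L.take i}) (L.get i)) :
    DepthGE L.length (I.map (algebraMap A (Localization.AtPrime m))) := by
  induction L generalizing I with
  | nil => trivial
  | cons x L ih =>
    refine ⟨algebraMap A _ x, ?_, ?_, ?_⟩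
    · exact (IsLocalization.AtPrime.to_map_mem_maximal_iff _ m x).2 (hm x (by simp))
    · have := h ⟨0, by simp⟩
      exact NonZeroDivMod.map_localization (by simpa using this)
    · have := ih (I := I ⊔ Ideal.span {x}) (fun y hy => hm y (List.mem_cons_of_mem _ hy)) ?_
      · rwa [Ideal.map_sup, Ideal.map_span, Set.image_singleton] at this
      · intro i
        have : NonZeroDivMod (I ⊔ Ideal.span {f | f ∈ x :: L.take i}) (L.get i) :=
          h ⟨i + 1, by simp⟩
        rw [sup_assoc, ← Ideal.span_union, Set.singleton_union]
        convert this using 4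
        ext f
        simp

lemma HomogIdeal.nonZeroDivMod_of_localization {w : σ → κ → ℕ} (hw : ∀ p, ∑ i, w p i = 1)
    {I : Ideal (MvPolynomial σ K)} (hI : HomogIdeal w I) {x : MvPolynomial σ K}
    (h : NonZeroDivMod (I.map (algebraMap _ (Localization.AtPrime (idealOfVars σ K))))
      (algebraMap _ (Localization.AtPrime (idealOfVars σ K)) x)) : NonZeroDivMod I x := by
  intro G hG
  have := h (algebraMap _ _ G) (by rw [← map_mul]; exact Ideal.mem_map_of_mem _ hG)
  rw [IsLocalization.algebraMap_mem_map_algebraMap_iff (idealOfVars σ K).primeCompl] at this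
  obtain ⟨t, ht, hG⟩ := this
  exact hI.mem_of_mul_mem hw ht hG

end Graded

/-! ### Hilbert functions modulo a regular element -/

section Hilbert

variable {σ K κ : Type*} [Field K]

lemma finiteDimensional_weightedHomogeneousSubmodule [Finite σ] [Fintype κ] {w : σ → κ → ℕ}
    (hw : ∀ p, ∑ i, w p i = 1) (d : κ → ℕ) :
    FiniteDimensional K (weightedHomogeneousSubmodule K w d) := by
  have hfg : FiniteDimensional K (weightedHomogeneousSubmodule K (fun _ : σ => 1) (∑ i, d i)) :=
    Module.Finite.iff_fg.2
      (weightedHomogeneousSubmodule_fg (R := K) (fun _ : σ => 1) (fun _ => one_ne_zero) _)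
  refine Submodule.finiteDimensional_of_le
    (S₂ := weightedHomogeneousSubmodule K (fun _ : σ => 1) (∑ i, d i)) ?_
  intro f hf e he
  have : Finsupp.weight w e = d := hf he
  rw [← this, sum_weight_apply hw]
  exact (DFunLike.congr_fun Finsupp.degree_eq_weight_one e).symm

lemma ghilb_sup_span_singleton [Finite σ] [Fintype κ] {w : σ → κ → ℕ}
    (hw : ∀ p, ∑ i, w p i = 1) {Q : Ideal (MvPolynomial σ K)} (hQ : HomogIdeal w Q)
    {l : MvPolynomial σ K} {e : κ → ℕ} (hl : IsWeightedHomogeneous w l e)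
    (hreg : NonZeroDivMod Q l) (d : κ → ℕ) [Decidable (e ≤ d)] :
    ghilb w (Q ⊔ Ideal.span {l}) d + (if e ≤ d then ghilb w Q (d - e) else 0) = ghilb w Q d := by
  have hfd := finiteDimensional_weightedHomogeneousSubmodule (K := K) hw
  set M := fun d => (weightedHomogeneousSubmodule K w d).map (Ideal.Quotient.mkₐ K Q).toLinearMap
    with hM
  let F : (MvPolynomial σ K ⧸ Q) →ₐ[K] (MvPolynomial σ K ⧸ (Q ⊔ Ideal.span {l})) :=
    Ideal.Quotient.factorₐ K le_sup_left
  have hF : ghilb w (Q ⊔ Ideal.span {l}) d = Module.finrank K ((M d).map F.toLinearMap) := by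
    rw [ghilb, hM, ← Submodule.map_comp]
    rfl
  have hrn := LinearMap.finrank_range_add_finrank_ker (F.toLinearMap.domRestrict (M d))
  rw [LinearMap.range_domRestrict] at hrn
  rw [hF, show ghilb w Q d = Module.finrank K (M d) from rfl, ← hrn]
  congr 1
  have hmul : Function.Injective (LinearMap.mulLeft K (Ideal.Quotient.mk Q l)) := by
    rw [← LinearMap.ker_eq_bot, LinearMap.ker_eq_bot']
    intro y hy
    obtain ⟨g, rfl⟩ := Ideal.Quotient.mk_surjective y
    rw [LinearMap.mulLeft_apply, ← map_mul, Ideal.Quotient.eq_zero_iff_mem] at hy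
    exact Ideal.Quotient.eq_zero_iff_mem.2 (hreg g hy)
  have hker : ∀ y ∈ M d, F y = 0 → ∃ h,
      y = Ideal.Quotient.mk Q (weightedHomogeneousComponent w d (l * h)) := by
    rintro _ ⟨f, hf, rfl⟩ hy
    have hy : Ideal.Quotient.mk (Q ⊔ Ideal.span {l}) f = 0 := hy
    rw [Ideal.Quotient.eq_zero_iff_mem] at hy
    obtain ⟨q, hq, r, hr, hqr⟩ := Submodule.mem_sup.1 hy
    obtain ⟨h, rfl⟩ := Ideal.mem_span_singleton'.1 hr
    refine ⟨h, ?_⟩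
    have := congrArg (weightedHomogeneousComponent w d) hqr
    rw [map_add, IsWeightedHomogeneous.weightedHomogeneousComponent_same hf] at this
    change Ideal.Quotient.mk Q f = _
    rw [Ideal.Quotient.mk_eq_mk_iff_sub_mem, ← this, mul_comm l]
    simpa using hQ q hq d
  rw [(Submodule.equivMapOfInjective _ (M d).subtype_injective _).finrank_eq]
  split_ifs with hed
  · have : (M (d - e)).map (LinearMap.mulLeft K (Ideal.Quotient.mk Q l)) =
        (LinearMap.ker (F.toLinearMap.domRestrict (M d))).map (M d).subtype := by
      apply le_antisymm
      · rintro _ ⟨_, ⟨g, hg, rfl⟩, rfl⟩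
        have hmem : Ideal.Quotient.mk Q (l * g) ∈ M d := by
          refine ⟨l * g, ?_, rfl⟩
          have := IsWeightedHomogeneous.mul hl hg
          rwa [add_tsub_cancel_of_le hed] at this
        refine ⟨⟨_, hmem⟩, ?_, map_mul (Ideal.Quotient.mk Q) l g⟩
        refine Ideal.Quotient.eq_zero_iff_mem.2 ?_
        exact Ideal.mem_sup_right (Ideal.mul_mem_right _ _ (Ideal.mem_span_singleton_self l))
      · rintro _ ⟨⟨y, hy⟩, hy0, rfl⟩
        obtain ⟨h, hh⟩ := hker y hy hy0
        rw [weightedHomogeneousComponent_mul_of_mem hl, if_pos hed] at hh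
        exact ⟨_, ⟨_, weightedHomogeneousComponent_mem w h _, rfl⟩,
          (map_mul (Ideal.Quotient.mk Q) l _).symm.trans hh.symm⟩
    rw [← this]
    exact (Submodule.equivMapOfInjective _ hmul (M (d - e))).finrank_eq
  · have : (LinearMap.ker (F.toLinearMap.domRestrict (M d))).map (M d).subtype = ⊥ := by
      rw [eq_bot_iff]
      rintro _ ⟨⟨y, hy⟩, hy0, rfl⟩
      obtain ⟨h, hh⟩ := hker y hy hy0
      rw [weightedHomogeneousComponent_mul_of_mem hl, if_neg hed, map_zero] at hh
      exact hh
    rw [this, finrank_bot]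

end Hilbert

section Difference

variable {k : ℕ}

lemma extNeg_eq_sum_powerset {G : Finset (Fin k) → (Fin k → ℕ) → ℕ}
    (h : ∀ s, ∀ i ∉ s, ∀ j, extNeg k (G (insert i s)) j =
      extNeg k (G s) j - extNeg k (G s) (fun a => j a - if a = i then 1 else 0))
    (s : Finset (Fin k)) (j : Fin k → ℤ) :
    extNeg k (G s) j = ∑ t ∈ s.powerset,
      (-1 : ℤ) ^ t.card * extNeg k (G ∅) (fun a => j a - if a ∈ t then 1 else 0) := by
  induction s using Finset.induction_on generalizing j with
  | empty => simp
  | insert i s hi ih =>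
    rw [h s i hi, ih, ih, Finset.sum_powerset_insert hi, sub_eq_add_neg, ← Finset.sum_neg_distrib]
    congr 1
    refine Finset.sum_congr rfl fun t ht => ?_
    have hit : i ∉ t := fun hh => hi (Finset.mem_powerset.1 ht hh)
    rw [Finset.card_insert_of_notMem hit, pow_succ]
    have : (fun a => j a - (if a = i then 1 else 0) - if a ∈ t then 1 else 0) =
        fun a => j a - if a ∈ insert i t then (1 : ℤ) else 0 := by
      funext a
      by_cases ha : a = i
      · subst ha; simp [hit]
      · simp [ha]
    rw [this]
    ring

lemma delta_eq_sum (H : (Fin k → ℕ) → ℕ) (d : Fin k → ℕ) :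
    delta k H d = ∑ t : Finset (Fin k),
      (-1 : ℤ) ^ t.card * extNeg k H (fun a => (d a : ℤ) - if a ∈ t then 1 else 0) := by
  refine Finset.sum_bij' (fun l _ => Finset.univ.filter fun i => l i = 1)
    (fun t _ i => if i ∈ t then 1 else 0) (by simp) (by simp) ?_ ?_ ?_
  · intro l _
    funext i
    have : ∀ x : Fin 2, (if x = 1 then (1 : Fin 2) else 0) = x := by decide
    simpa using this (l i)
  · intro t _
    ext i
    simp
  · intro l _
    have h1 : ∀ i, ((l i : Fin 2) : ℕ) = if l i = 1 then 1 else 0 := by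
      intro i
      have : ∀ x : Fin 2, (x : ℕ) = if x = 1 then 1 else 0 := by decide
      exact this (l i)
    simp only [h1, Finset.sum_ite, Finset.mem_filter, Finset.mem_univ, true_and]
    simp

lemma delta_injective {H H' : (Fin k → ℕ) → ℕ} (h : ∀ d, delta k H d = delta k H' d) :
    H = H' := by
  suffices ∀ N, ∀ d, ∑ i, d i = N → H d = H' d from funext fun d => this _ d rfl
  intro N
  induction N using Nat.strong_induction_on with
  | _ N ih =>
    intro d hd
    have h1 := h d
    rw [delta_eq_sum, delta_eq_sum, ← Finset.add_sum_erase _ _ (Finset.mem_univ ∅),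
      ← Finset.add_sum_erase _ _ (Finset.mem_univ ∅)] at h1
    have h2 : ∀ t ∈ Finset.univ.erase (∅ : Finset (Fin k)),
        extNeg k H (fun a => (d a : ℤ) - if a ∈ t then 1 else 0) =
        extNeg k H' (fun a => (d a : ℤ) - if a ∈ t then 1 else 0) := by
      intro t ht
      rw [extNeg, extNeg]
      split_ifs with hpos
      · rw [ih _ ?_ _ rfl]
        rw [← hd]
        obtain ⟨i, hi⟩ := Finset.nonempty_iff_ne_empty.2 (Finset.mem_erase.1 ht).1
        refine Finset.sum_lt_sum (fun a _ => ?_) ⟨i, Finset.mem_univ _, ?_⟩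
        · split_ifs <;> omega
        · have := hpos i
          simp only [hi, if_true] at this ⊢
          omega
      · rfl
    rw [Finset.sum_congr rfl fun t ht => by rw [h2 t ht], add_left_inj] at h1
    simpa [extNeg] using h1

end Difference

section Hilbert

variable {σ K : Type*} [Field K] {k : ℕ}

/-- The Hilbert function modulo a regular sequence of linear forms is the first difference. -/
lemma ghilb_sup_span_range [Finite σ] {w : σ → Fin k → ℕ}
    (hw : ∀ p, ∑ i, w p i = 1) {I : Ideal (MvPolynomial σ K)} (hI : HomogIdeal w I)
    {L : Fin k → MvPolynomial σ K} (hL : ∀ i, IsWeightedHomogeneous w (L i) (Pi.single i 1))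
    (hreg : ∀ s : Finset (Fin k), ∀ i ∉ s, NonZeroDivMod (I ⊔ Ideal.span (L '' s)) (L i))
    (d : Fin k → ℕ) :
    (ghilb w (I ⊔ Ideal.span (Set.range L)) d : ℤ) = delta k (ghilb w I) d := by
  have key := extNeg_eq_sum_powerset (G := fun s => ghilb w (I ⊔ Ideal.span (L '' s))) ?_
    Finset.univ (fun a => d a)
  · rw [delta_eq_sum]
    simpa [extNeg] using key
  · intro s i hi j
    classical
    have hQ : HomogIdeal w (I ⊔ Ideal.span (L '' s)) := by
      refine hI.sup (HomogIdeal.span ?_)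
      rintro _ ⟨i, -, rfl⟩
      exact ⟨_, hL i⟩
    have hstep := ghilb_sup_span_singleton hw hQ (hL i) (hreg s i hi)
    rw [Finset.coe_insert, Set.image_insert_eq, Set.insert_eq, Set.union_comm,
      Ideal.span_union, ← sup_assoc]
    by_cases hj : ∀ a, 0 ≤ j a
    · have hle : Pi.single i 1 ≤ (fun a => (j a).toNat) ↔ 1 ≤ j i := by
        constructor
        · intro h
          have := h i
          simp at this
          omega
        · intro h a
          by_cases ha : a = i
          · subst ha; simp; omega
          · simp [ha]
      have := hstep fun a => (j a).toNat
      rw [extNeg, extNeg, extNeg, if_pos hj, if_pos hj]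
      rw [if_congr hle rfl rfl] at this
      have h3 : (∀ a, 0 ≤ j a - if a = i then 1 else 0) ↔ 1 ≤ j i := by
        constructor
        · intro h
          have := h i
          simp at this
          omega
        · intro h a
          have := hj a
          by_cases ha : a = i
          · subst ha; simp; omega
          · simp [ha, this]
      rw [if_congr h3 rfl rfl, ← this]
      split_ifs with h4
      · have : (fun a => (j a).toNat) - Pi.single i 1 =
            fun a => (j a - if a = i then 1 else 0).toNat := by
          funext a
          by_cases ha : a = i
          · subst ha; simp
          · simp [ha]
        rw [this]
        push_cast
        ring
      · simp
    · rw [extNeg, extNeg, extNeg, if_neg hj, if_neg hj, if_neg]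
      · simp
      · push Not at hj ⊢
        obtain ⟨a, ha⟩ := hj
        refine ⟨a, ?_⟩
        split_ifs <;> omega

end Hilbert

/-! ### Linear systems of parameters in graded rings -/

section Parameters

variable {σ K κ ι : Type*} [Field K]

lemma maximalIdeal_le_radical_map {A : Type*} [CommRing A] {m : Ideal A} [m.IsPrime] {Q : Ideal A}
    (h : m ≤ Q.radical) :
    IsLocalRing.maximalIdeal (Localization.AtPrime m) ≤
      (Q.map (algebraMap A (Localization.AtPrime m))).radical := by
  rw [← IsLocalization.AtPrime.map_eq_maximalIdeal m]
  exact (Ideal.map_mono h).trans (Ideal.map_radical_le _)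

lemma length_le_card_of_isRegular [Finite σ] [Fintype ι] {I : Ideal (MvPolynomial σ K)}
    (hI : I ≤ idealOfVars σ K) {l : ι → MvPolynomial σ K} (hl : ∀ i, l i ∈ idealOfVars σ K)
    (hrad : idealOfVars σ K ≤ (I ⊔ Ideal.span (Set.range l)).radical)
    {L : List (MvPolynomial σ K)} (hm : ∀ x ∈ L, x ∈ idealOfVars σ K)
    (h : ∀ i : Fin L.length, NonZeroDivMod (I ⊔ Ideal.span {f | f ∈ L.take i}) (L.get i)) :
    L.length ≤ Fintype.card ι := by
  have hD := depthGE_of_isRegular (m := idealOfVars σ K) L hm h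
  refine hD.le_card ?_ (L := fun i => algebraMap _ _ (l i)) (s := Finset.univ) ?_ ?_
  · refine ne_top_of_le_ne_top (b := IsLocalRing.maximalIdeal _) Ideal.IsPrime.ne_top'
      (Ideal.map_le_iff_le_comap.2 (hI.trans ?_))
    exact (IsLocalization.AtPrime.under_maximalIdeal _ (idealOfVars σ K)).ge
  · exact fun i _ => (IsLocalization.AtPrime.to_map_mem_maximal_iff _ _ (l i)).2 (hl i)
  · have := maximalIdeal_le_radical_map hrad
    rw [Ideal.map_sup, Ideal.map_span, ← Set.range_comp] at this
    rwa [Finset.coe_univ, Set.image_univ]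

lemma nonZeroDivMod_sup_of_isRegular [Finite σ] [Fintype κ] [Fintype ι] {w : σ → κ → ℕ}
    (hw : ∀ p, ∑ i, w p i = 1) {I : Ideal (MvPolynomial σ K)} (hI : HomogIdeal w I)
    {l : ι → MvPolynomial σ K} (hl : ∀ i, l i ∈ idealOfVars σ K)
    (hlw : ∀ i, ∃ e, IsWeightedHomogeneous w (l i) e)
    (hrad : idealOfVars σ K ≤ (I ⊔ Ideal.span (Set.range l)).radical)
    {L : List (MvPolynomial σ K)} (hm : ∀ x ∈ L, x ∈ idealOfVars σ K)
    (h : ∀ i : Fin L.length, NonZeroDivMod (I ⊔ Ideal.span {f | f ∈ L.take i}) (L.get i))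
    (hcard : L.length = Fintype.card ι) (s : Finset ι) (i : ι) (hi : i ∉ s) :
    NonZeroDivMod (I ⊔ Ideal.span (l '' s)) (l i) := by
  have hD := depthGE_of_isRegular (m := idealOfVars σ K) L hm h
  rw [hcard] at hD
  refine (hI.sup (HomogIdeal.span ?_)).nonZeroDivMod_of_localization hw ?_
  · rintro _ ⟨j, -, rfl⟩
    exact hlw j
  · rw [Ideal.map_sup, Ideal.map_span, ← Set.image_comp]
    refine DepthGE.nonZeroDivMod_sup (L := fun i => algebraMap _ _ (l i)) (s := Finset.univ)
      hD ?_ ?_ (Finset.subset_univ s) (Finset.mem_univ i) hi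
    · exact fun i _ => (IsLocalization.AtPrime.to_map_mem_maximal_iff _ _ (l i)).2 (hl i)
    · have := maximalIdeal_le_radical_map hrad
      rw [Ideal.map_sup, Ideal.map_span, ← Set.range_comp] at this
      rwa [Finset.coe_univ, Set.image_univ]

end Parameters

section Hom

variable {σ τ K κ : Type*} [Field K]

lemma isWeightedHomogeneous_aeval {w : σ → κ → ℕ} {v : τ → κ → ℕ} {g : σ → MvPolynomial τ K}
    (hg : ∀ p, IsWeightedHomogeneous v (g p) (w p)) {f : MvPolynomial σ K} {d : κ → ℕ}
    (hf : IsWeightedHomogeneous w f d) : IsWeightedHomogeneous v (aeval g f) d := by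
  rw [aeval_def, eval₂_eq]
  refine IsWeightedHomogeneous.sum _ _ _ fun e he => ?_
  rw [← hf (mem_support_iff.1 he), ← zero_add (Finsupp.weight w e)]
  refine (isWeightedHomogeneous_C _ _).mul ?_
  rw [Finsupp.weight_apply, Finsupp.sum]
  exact IsWeightedHomogeneous.prod _ _ _ fun p _ => (hg p).pow _

lemma weightedHomogeneousComponent_aeval {w : σ → κ → ℕ} {v : τ → κ → ℕ}
    {g : σ → MvPolynomial τ K} (hg : ∀ p, IsWeightedHomogeneous v (g p) (w p))
    (f : MvPolynomial σ K) (d : κ → ℕ) :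
    weightedHomogeneousComponent v d (aeval g f) =
      aeval g (weightedHomogeneousComponent w d f) := by
  induction f using MvPolynomial.induction_on' with
  | monomial e c =>
    have h1 := isWeightedHomogeneous_monomial w e c rfl
    have h2 := isWeightedHomogeneous_aeval hg h1
    by_cases hd : Finsupp.weight w e = d
    · subst hd
      rw [h2.weightedHomogeneousComponent_same, h1.weightedHomogeneousComponent_same]
    · rw [h2.weightedHomogeneousComponent_ne _ (Ne.symm hd),
        h1.weightedHomogeneousComponent_ne _ (Ne.symm hd), map_zero]
  | add p q hp hq => simp only [map_add, hp, hq]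

end Hom

/-! ### Ideals of points in multiprojective space -/

section Points

variable {K : Type} [Field K] {k : ℕ} {n : Fin k → ℕ}

lemma sum_wt (p : Sig k n) : ∑ i, wt k n p i = 1 := by
  simp [wt]

lemma weight_wt_apply (e : Sig k n →₀ ℕ) (i : Fin k) :
    Finsupp.weight (wt k n) e i = ∑ j, e ⟨i, j⟩ := by
  rw [Finsupp.weight_apply, Finsupp.sum_fintype _ _ (by simp), Finset.sum_apply, Fintype.sum_sigma,
    Finset.sum_eq_single i]
  · simp [wt]
  · intro b _ hb
    simp [wt, hb.symm]
  · simp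

/-- Rescaling each block of coordinates. -/
def blockScale (t : Fin k → K) (x : Sig k n → K) : Sig k n → K := fun p => t p.1 * x p

lemma eval_blockScale {f : MPRing K k n} {d : Fin k → ℕ} (hf : IsWeightedHomogeneous (wt k n) f d)
    (t : Fin k → K) (x : Sig k n → K) :
    eval (blockScale t x) f = (∏ i, t i ^ d i) * eval x f := by
  rw [eval_eq', eval_eq', Finset.mul_sum]
  refine Finset.sum_congr rfl fun e he => ?_
  have : ∏ p, blockScale t x p ^ e p = (∏ i, t i ^ d i) * ∏ p, x p ^ e p := by
    simp only [blockScale, mul_pow, Finset.prod_mul_distrib]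
    congr 1
    rw [Fintype.prod_sigma]
    refine Finset.prod_congr rfl fun i _ => ?_
    change ∏ j, t i ^ e ⟨i, j⟩ = t i ^ d i
    rw [Finset.prod_pow_eq_pow_sum, ← weight_wt_apply, hf (mem_support_iff.1 he)]
  rw [this]
  ring

lemma eval_weightedHomogeneousComponent_eq_zero [Infinite K] {f : MPRing K k n} {x : Sig k n → K}
    (h : ∀ t : Fin k → K, eval (blockScale t x) f = 0) (d : Fin k → ℕ) :
    eval x (weightedHomogeneousComponent (wt k n) d f) = 0 := by
  have hfin : (Function.support fun d => weightedHomogeneousComponent (wt k n) d f).Finite :=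
    weightedHomogeneousComponent_finsupp f
  set q : MvPolynomial (Fin k) K := ∑ d ∈ Set.Finite.toFinset hfin,
    monomial (Finsupp.equivFunOnFinite.symm d) (eval x (weightedHomogeneousComponent (wt k n) d f))
    with hq
  have hq0 : q = 0 := by
    refine MvPolynomial.funext fun t => ?_
    rw [map_zero, ← h t]
    conv_rhs => rw [← sum_weightedHomogeneousComponent (wt k n) f, finsum_eq_sum _ hfin]
    rw [hq, map_sum, map_sum]
    refine Finset.sum_congr rfl fun d _ => ?_
    rw [eval_blockScale (weightedHomogeneousComponent_isWeightedHomogeneous d f), eval_monomial,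
      Finsupp.prod_fintype _ _ (by simp)]
    simp [mul_comm]
  by_contra hne
  have hd : d ∈ Set.Finite.toFinset hfin := by
    rw [Set.Finite.mem_toFinset]
    intro h0
    exact hne (by simp [show weightedHomogeneousComponent (wt k n) d f = 0 from h0])
  have := congrArg (coeff (Finsupp.equivFunOnFinite.symm d)) hq0
  classical
  rw [hq, coeff_sum, Finset.sum_eq_single_of_mem d hd] at this
  · simp [hne] at this
  · intro b _ hb
    rw [coeff_monomial, if_neg]
    simpa using hb

lemma mem_idealOfPoint {P : MPPoint K k n} {f : MPRing K k n} :
    f ∈ idealOfPoint K k n P ↔ ∀ x ∈ cone K k n P, eval x f = 0 := by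
  simp [idealOfPoint, vanishingIdeal, RingHom.mem_ker]

lemma mem_idealOfSet {X : Set (MPPoint K k n)} {f : MPRing K k n} :
    f ∈ idealOfSet K k n X ↔ ∀ P ∈ X, ∀ x ∈ cone K k n P, eval x f = 0 := by
  simp [idealOfSet, mem_idealOfPoint]

lemma homogIdeal_idealOfSet [Infinite K] (X : Set (MPPoint K k n)) :
    HomogIdeal (wt k n) (idealOfSet K k n X) := by
  intro f hf d
  rw [mem_idealOfSet] at hf ⊢
  intro P hP x hx
  refine eval_weightedHomogeneousComponent_eq_zero (fun t => hf P hP _ fun i => ?_) d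
  obtain ⟨c, hc⟩ := hx i
  refine ⟨t i * c, ?_⟩
  rw [mul_smul, ← hc]
  rfl

/-- The linear form of degree `e_i` with the given coefficients. -/
def linForm (a : Sig k n → K) (i : Fin k) : MPRing K k n := ∑ j, C (a ⟨i, j⟩) * X ⟨i, j⟩

lemma isWeightedHomogeneous_linForm (a : Sig k n → K) (i : Fin k) :
    IsWeightedHomogeneous (wt k n) (linForm a i) (Pi.single i 1) := by
  refine IsWeightedHomogeneous.sum _ _ _ fun j _ => ?_
  exact (isWeightedHomogeneous_X K (wt k n) ⟨i, j⟩).C_mul _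

lemma linForm_mem (a : Sig k n → K) (i : Fin k) : linForm a i ∈ maxIdeal K k n :=
  Ideal.sum_mem _ fun _ _ => Ideal.mul_mem_left _ _ (Ideal.subset_span ⟨_, rfl⟩)

lemma X_pow_mem_sup {X : Set (MPPoint K k n)} (hX : X.Finite) {a : Sig k n → K}
    (ha : ∀ P ∈ X, ∀ i, ∑ j, a ⟨i, j⟩ * (P i).rep j ≠ 0) (p : Sig k n) :
    (MvPolynomial.X p : MPRing K k n) ^ hX.toFinset.card ∈
      idealOfSet K k n X ⊔ Ideal.span (Set.range (linForm a)) := by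
  set b : MPPoint K k n → K := fun P => (P p.1).rep p.2 / ∑ j, a ⟨p.1, j⟩ * (P p.1).rep j with hb
  have h1 : ∏ P ∈ hX.toFinset, (MvPolynomial.X p - C (b P) * linForm a p.1) ∈
      idealOfSet K k n X := by
    rw [mem_idealOfSet]
    intro P hP x hx
    rw [map_prod]
    refine Finset.prod_eq_zero (hX.mem_toFinset.2 hP) ?_
    obtain ⟨c, hc⟩ := hx p.1
    have hc' : ∀ j, x ⟨p.1, j⟩ = c * (P p.1).rep j := fun j => congrFun hc j
    have h2 : x p = c * (P p.1).rep p.2 := hc' p.2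
    simp only [linForm, map_sub, eval_X, map_mul, eval_C, map_sum, hc', hb]
    have := ha P hP p.1
    have h3 : ∑ j, a ⟨p.1, j⟩ * (c * (P p.1).rep j) = c * ∑ j, a ⟨p.1, j⟩ * (P p.1).rep j := by
      rw [Finset.mul_sum]
      exact Finset.sum_congr rfl fun j _ => by ring
    rw [h3]
    field_simp
    ring
  have h2 := Ideal.mem_sup_left (S := idealOfSet K k n X)
    (T := Ideal.span (Set.range (linForm a))) h1
  rw [← Ideal.Quotient.eq_zero_iff_mem, map_prod] at h2
  rw [← Ideal.Quotient.eq_zero_iff_mem, map_pow, ← h2, ← Finset.prod_const]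
  refine Finset.prod_congr rfl fun P _ => ?_
  rw [Ideal.Quotient.mk_eq_mk_iff_sub_mem, sub_sub_cancel]
  exact Ideal.mul_mem_left _ _ (Ideal.mem_sup_right (Ideal.subset_span ⟨_, rfl⟩))

lemma maxIdeal_le_radical {X : Set (MPPoint K k n)} (hX : X.Finite) {a : Sig k n → K}
    (ha : ∀ P ∈ X, ∀ i, ∑ j, a ⟨i, j⟩ * (P i).rep j ≠ 0) :
    idealOfVars (Sig k n) K ≤
      (idealOfSet K k n X ⊔ Ideal.span (Set.range (linForm a))).radical := by
  rw [idealOfVars, Ideal.span_le]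
  rintro _ ⟨p, rfl⟩
  exact ⟨_, X_pow_mem_sup hX ha p⟩

lemma idealOfSet_le {X : Set (MPPoint K k n)} (hX : X.Nonempty) :
    idealOfSet K k n X ≤ idealOfVars (Sig k n) K := by
  intro f hf
  obtain ⟨P, hP⟩ := hX
  rw [idealOfVars_eq_ker, RingHom.mem_ker, ← eval_zero]
  exact mem_idealOfSet.1 hf P hP 0 fun i => ⟨0, by simp; rfl⟩

lemma exists_linForm [Infinite K] {X : Set (MPPoint K k n)} (hX : X.Finite) :
    ∃ a : Sig k n → K, (∀ i, a ⟨i, 0⟩ = 1) ∧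
      ∀ P ∈ X, ∀ i, ∑ j, a ⟨i, j⟩ * (P i).rep j ≠ 0 := by
  have : ∀ i, ∃ b : Fin (n i + 1) → K, b 0 = 1 ∧ ∀ P ∈ X, ∑ j, b j * (P i).rep j ≠ 0 := by
    intro i
    have := hX.to_subtype
    obtain ⟨f, hf⟩ := Module.exists_dual_forall_apply_ne_zero (K := K)
      (fun o : Option X => o.elim (Pi.single 0 1 : Fin (n i + 1) → K) (fun P => (P.1 i).rep)) (by
        rintro (_ | P)
        · simp
        · exact (P.1 i).rep_nonzero)
    have h0 : f (Pi.single 0 1) ≠ 0 := hf none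
    refine ⟨fun j => f (Pi.single j 1) / f (Pi.single 0 1), div_self h0, fun P hP => ?_⟩
    have h1 : f (P i).rep ≠ 0 := hf (some ⟨P, hP⟩)
    have h2 : f (P i).rep = ∑ j, f (Pi.single j 1) * (P i).rep j := by
      conv_lhs => rw [pi_eq_sum_univ' (P i).rep, map_sum]
      simp [mul_comm]
    rw [h2] at h1
    simp only [div_mul_eq_mul_div, ← Finset.sum_div]
    exact div_ne_zero h1 h0
  choose b hb0 hb using this
  exact ⟨fun p => b p.1 p.2, hb0, fun P hP i => hb i P hP⟩

end Points

/-! ### Eliminating one linear form in each block -/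

section Elimination

variable {K : Type} [Field K] {k : ℕ} {n : Fin k → ℕ}

/-- The substitution eliminating `x_{i,0}` by means of a linear form with coefficients `a`. -/
def elim (a : Sig k n → K) : MPRing K k n →ₐ[K] SRing K k n :=
  aeval fun p => Fin.cases (-∑ j, C (a ⟨p.1, Fin.succ j⟩) * X ⟨p.1, j⟩)
    (fun j => X ⟨p.1, j⟩) p.2

/-- The inclusion of `S` into `R`. -/
def incl : SRing K k n →ₐ[K] MPRing K k n :=
  aeval fun p => X ⟨p.1, p.2.succ⟩

@[simp] lemma elim_X_zero (a : Sig k n → K) (i : Fin k) :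
    elim a (X ⟨i, 0⟩) = -∑ j, C (a ⟨i, Fin.succ j⟩) * X ⟨i, j⟩ := by
  simp [elim]

@[simp] lemma elim_X_succ (a : Sig k n → K) (i : Fin k) (j : Fin (n i)) :
    elim a (X ⟨i, j.succ⟩) = X ⟨i, j⟩ := by
  simp [elim]

@[simp] lemma incl_X (p : SigS k n) :
    incl (X p : SRing K k n) = X ⟨p.1, p.2.succ⟩ := by
  simp [incl]

lemma elim_incl (a : Sig k n → K) (f : SRing K k n) : elim a (incl f) = f := by
  have : (elim a).comp incl = AlgHom.id K (SRing K k n) := by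
    ext p
    simp
  exact DFunLike.congr_fun this f

lemma elim_surjective (a : Sig k n → K) : Function.Surjective (elim a) :=
  fun f => ⟨_, elim_incl a f⟩

lemma elim_linForm {a : Sig k n → K} (ha : ∀ i, a ⟨i, 0⟩ = 1) (i : Fin k) :
    elim a (linForm a i) = 0 := by
  simp [linForm, Fin.sum_univ_succ, ha, MvPolynomial.algHom_C, MvPolynomial.algebraMap_eq]

lemma sub_incl_elim_mem {a : Sig k n → K} (ha : ∀ i, a ⟨i, 0⟩ = 1) (f : MPRing K k n) :
    f - incl (elim a f) ∈ Ideal.span (Set.range (linForm a)) := by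
  rw [← Ideal.Quotient.mk_eq_mk_iff_sub_mem]
  have : Ideal.Quotient.mkₐ K (Ideal.span (Set.range (linForm a))) =
      ((Ideal.Quotient.mkₐ K _).comp incl).comp (elim a) := by
    ext ⟨i, j⟩
    refine Fin.cases ?_ (fun j => ?_) j
    · refine (Ideal.Quotient.mk_eq_mk_iff_sub_mem _ _).2 (Ideal.subset_span ⟨i, ?_⟩)
      simp [linForm, Fin.sum_univ_succ, ha, MvPolynomial.algHom_C, MvPolynomial.algebraMap_eq]
    · simp
  exact DFunLike.congr_fun this f

lemma ker_elim {a : Sig k n → K} (ha : ∀ i, a ⟨i, 0⟩ = 1) :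
    RingHom.ker (elim a) = Ideal.span (Set.range (linForm a)) := by
  refine le_antisymm (fun f hf => ?_) (Ideal.span_le.2 ?_)
  · have := sub_incl_elim_mem ha f
    rwa [RingHom.mem_ker.1 hf, map_zero, sub_zero] at this
  · rintro _ ⟨i, rfl⟩
    exact elim_linForm ha i

lemma comap_elim {a : Sig k n → K} (ha : ∀ i, a ⟨i, 0⟩ = 1) (I : Ideal (MPRing K k n)) :
    (I.map (elim a)).comap (elim a) = I ⊔ Ideal.span (Set.range (linForm a)) := by
  rw [Ideal.comap_map_of_surjective _ (elim_surjective a), ← ker_elim ha]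
  rfl

lemma isWeightedHomogeneous_elim_X (a : Sig k n → K) (p : Sig k n) :
    IsWeightedHomogeneous (wtS k n) (Fin.cases (motive := fun _ => SRing K k n)
      (-∑ j, C (a ⟨p.1, Fin.succ j⟩) * X ⟨p.1, j⟩) (fun j => X ⟨p.1, j⟩) p.2) (wt k n p) := by
  obtain ⟨i, j⟩ := p
  refine Fin.cases ?_ (fun j => ?_) j
  · refine (weightedHomogeneousSubmodule K (wtS k n) (Pi.single i 1)).neg_mem ?_
    refine Submodule.sum_mem _ fun j _ => ?_
    exact (isWeightedHomogeneous_X K (wtS k n) ⟨i, j⟩).C_mul _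
  · exact isWeightedHomogeneous_X K (wtS k n) ⟨i, j⟩

lemma isWeightedHomogeneous_elim (a : Sig k n → K) {f : MPRing K k n} {d : Fin k → ℕ}
    (hf : IsWeightedHomogeneous (wt k n) f d) : IsWeightedHomogeneous (wtS k n) (elim a f) d :=
  isWeightedHomogeneous_aeval (isWeightedHomogeneous_elim_X a) hf

lemma isWeightedHomogeneous_incl {f : SRing K k n} {d : Fin k → ℕ}
    (hf : IsWeightedHomogeneous (wtS k n) f d) : IsWeightedHomogeneous (wt k n) (incl f) d := by
  have h : ∀ p : SigS k n, IsWeightedHomogeneous (wt k n)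
      (X ⟨p.1, p.2.succ⟩ : MPRing K k n) (wtS k n p) :=
    fun p => isWeightedHomogeneous_X K (wt k n) ⟨p.1, p.2.succ⟩
  exact isWeightedHomogeneous_aeval h hf

lemma homogIdeal_map_elim (a : Sig k n → K) {I : Ideal (MPRing K k n)}
    (hI : HomogIdeal (wt k n) I) : HomogIdeal (wtS k n) (I.map (elim a)) := by
  intro f hf d
  obtain ⟨g, hg, rfl⟩ := (Ideal.mem_map_iff_of_surjective _ (elim_surjective a)).1 hf
  have : weightedHomogeneousComponent (wtS k n) d (elim a g) =
      elim a (weightedHomogeneousComponent (wt k n) d g) :=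
    weightedHomogeneousComponent_aeval (isWeightedHomogeneous_elim_X a) g d
  rw [this]
  exact Ideal.mem_map_of_mem _ (hI g hg d)

lemma ghilb_map_elim {a : Sig k n → K} (ha : ∀ i, a ⟨i, 0⟩ = 1) (I : Ideal (MPRing K k n))
    (d : Fin k → ℕ) :
    ghilb (wtS k n) (I.map (elim a)) d =
      ghilb (wt k n) (I ⊔ Ideal.span (Set.range (linForm a))) d := by
  rw [← comap_elim ha]
  set J := I.map (elim a)
  let ψ : (MPRing K k n ⧸ J.comap (elim a)) →ₐ[K] (SRing K k n ⧸ J) :=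
    Ideal.quotientMapₐ J (elim a) le_rfl
  have hψ : Function.Injective ψ.toLinearMap :=
    Ideal.quotientMap_injective (f := (elim a).toRingHom)
  have : (weightedHomogeneousSubmodule K (wtS k n) d).map (Ideal.Quotient.mkₐ K J).toLinearMap =
      ((weightedHomogeneousSubmodule K (wt k n) d).map
        (Ideal.Quotient.mkₐ K (J.comap (elim a))).toLinearMap).map ψ.toLinearMap := by
    ext y
    constructor
    · rintro ⟨f, hf, rfl⟩
      refine ⟨_, ⟨incl f, isWeightedHomogeneous_incl hf, rfl⟩, ?_⟩
      change Ideal.Quotient.mk J (elim a (incl f)) = _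
      rw [elim_incl]
      rfl
    · rintro ⟨_, ⟨f, hf, rfl⟩, rfl⟩
      exact ⟨elim a f, isWeightedHomogeneous_elim a hf, rfl⟩
  rw [ghilb, this]
  exact (Submodule.equivMapOfInjective _ hψ _).finrank_eq.symm

lemma isPrime_span_range_X {σ : Type*} :
    (Ideal.span (Set.range (X : σ → MvPolynomial σ K))).IsPrime :=
  (isMaximal_idealOfVars (σ := σ) (K := K)).isPrime

lemma isArtinianIdealS_map_elim {X : Set (MPPoint K k n)} (hX : X.Finite) (hne : X.Nonempty)
    {a : Sig k n → K} (ha : ∀ i, a ⟨i, 0⟩ = 1)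
    (haX : ∀ P ∈ X, ∀ i, ∑ j, a ⟨i, j⟩ * (P i).rep j ≠ 0) :
    IsArtinianIdealS K k n ((idealOfSet K k n X).map (elim a)) := by
  refine le_antisymm ?_ (Ideal.span_le.2 ?_)
  · refine isPrime_span_range_X.radical_le_iff.2 ?_
    rw [Ideal.map_le_iff_le_comap]
    refine (idealOfSet_le hne).trans (Ideal.span_le.2 ?_)
    rintro _ ⟨⟨i, j⟩, rfl⟩
    refine Fin.cases ?_ (fun j => ?_) j
    · rw [SetLike.mem_coe, Ideal.mem_comap, elim_X_zero]
      exact neg_mem (Ideal.sum_mem _ fun j _ =>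
        Ideal.mul_mem_left _ _ (Ideal.subset_span ⟨_, rfl⟩))
    · rw [SetLike.mem_coe, Ideal.mem_comap, elim_X_succ]
      exact Ideal.subset_span ⟨_, rfl⟩
  · rintro _ ⟨p, rfl⟩
    refine ⟨hX.toFinset.card, ?_⟩
    have := X_pow_mem_sup hX haX ⟨p.1, p.2.succ⟩
    rw [← comap_elim ha, Ideal.mem_comap] at this
    simpa using this

end Elimination

/-! ### Artinian reductions of arithmetically Cohen–Macaulay sets of points -/

section Reduction

variable {K : Type} [Field K] {k : ℕ} {n : Fin k → ℕ}

lemma isWeightedHomogeneous_linForm' (a : Sig k n → K) (i : Fin k) :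
    ∃ e, IsWeightedHomogeneous (wt k n) (linForm a i) e :=
  ⟨_, isWeightedHomogeneous_linForm a i⟩

lemma hilbS_map_elim [Infinite K] (X : Set (MPPoint K k n)) {a : Sig k n → K}
    (ha : ∀ i, a ⟨i, 0⟩ = 1)
    (hreg : ∀ s : Finset (Fin k), ∀ i ∉ s,
      NonZeroDivMod (idealOfSet K k n X ⊔ Ideal.span (linForm a '' s)) (linForm a i))
    (d : Fin k → ℕ) :
    (hilbS K k n ((idealOfSet K k n X).map (elim a)) d : ℤ) =
      delta k (hilb K k n (idealOfSet K k n X)) d :=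
  (congrArg Nat.cast (ghilb_map_elim ha _ d)).trans
    (ghilb_sup_span_range sum_wt (homogIdeal_idealOfSet X) (isWeightedHomogeneous_linForm a) hreg d)

lemma nonempty_of_isACM {X : Set (MPPoint K k n)} (hX : IsACM K k n X) : X.Nonempty := by
  obtain ⟨⟨L, -, hL, -⟩, -⟩ := hX
  by_contra h
  rw [Set.not_nonempty_iff_eq_empty] at h
  subst h
  refine (isPrime_span_range_X (K := K) (σ := Sig k n)).ne_top (top_le_iff.1 (le_trans ?_ hL))
  simp [idealOfSet]

lemma exists_artinian_of_isACM [Infinite K] {X : Set (MPPoint K k n)} (hX : X.Finite)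
    (hACM : IsACM K k n X) :
    ∃ J : Ideal (SRing K k n), IsHomogIdealS K k n J ∧ IsArtinianIdealS K k n J ∧
      ∀ d, (hilbS K k n J d : ℤ) = delta k (hilb K k n (idealOfSet K k n X)) d := by
  obtain ⟨a, ha, haX⟩ := exists_linForm hX
  refine ⟨_, homogIdeal_map_elim a (homogIdeal_idealOfSet X),
    isArtinianIdealS_map_elim hX (nonempty_of_isACM hACM) ha haX, hilbS_map_elim X ha ?_⟩
  obtain ⟨⟨L, hLk, hL, hreg⟩, -⟩ := hACM
  exact nonZeroDivMod_sup_of_isRegular sum_wt (homogIdeal_idealOfSet X) (linForm_mem a)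
    (isWeightedHomogeneous_linForm' a) (maxIdeal_le_radical hX haX)
    (fun x hx => hL (Ideal.mem_sup_right (Ideal.subset_span hx))) hreg (by simpa using hLk)

lemma isACM_of_nonZeroDivMod {X : Set (MPPoint K k n)} (hX : X.Finite) (hne : X.Nonempty)
    {a : Sig k n → K} (haX : ∀ P ∈ X, ∀ i, ∑ j, a ⟨i, j⟩ * (P i).rep j ≠ 0)
    (hreg : ∀ s : Finset (Fin k), ∀ i ∉ s,
      NonZeroDivMod (idealOfSet K k n X ⊔ Ideal.span (linForm a '' s)) (linForm a i)) :
    IsACM K k n X := by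
  constructor
  · refine ⟨List.ofFn (linForm a), by simp, sup_le (idealOfSet_le hne) ?_, fun i => ?_⟩
    · refine Ideal.span_le.2 fun f hf => ?_
      obtain ⟨i, rfl⟩ := List.mem_ofFn.1 hf
      exact linForm_mem a i
    · have hi : (i : ℕ) < k := by simpa using i.2
      have hset : {f | f ∈ (List.ofFn (linForm a)).take i} =
          linForm a '' ((Finset.univ.filter fun j : Fin k => (j : ℕ) < i : Finset (Fin k)) :
            Set (Fin k)) := by
        ext f
        simp only [Set.mem_ofPred_eq, List.mem_take_iff_getElem, Set.mem_image, Finset.coe_filter,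
          Finset.mem_univ, true_and]
        constructor
        · rintro ⟨j, hj, rfl⟩
          have hj' : j < k := by simp at hj; omega
          exact ⟨⟨j, hj'⟩, by simp at hj ⊢; omega, by simp⟩
        · rintro ⟨j, hj, rfl⟩
          exact ⟨j, by simp; omega, by simp⟩
      rw [hset]
      have := hreg (Finset.univ.filter fun j : Fin k => (j : ℕ) < i) ⟨i, hi⟩ (by simp)
      simpa [NonZeroDivMod] using this
  · rintro r ⟨L, rfl, hL, hreg⟩
    simpa using length_le_card_of_isRegular (idealOfSet_le hne) (linForm_mem a)
      (maxIdeal_le_radical hX haX)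
      (fun x hx => hL (Ideal.mem_sup_right (Ideal.subset_span hx))) hreg

end Reduction

/-! ### Standard monomials -/

section Standard

variable {K : Type*} [Field K] {σ κ : Type*}

/-- The monomials with exponents in `B` form a basis of the quotient by `J`. -/
structure IsStandard (J : Ideal (MvPolynomial σ K)) (B : Set (σ →₀ ℕ)) : Prop where
  eq_zero : ∀ f ∈ J, f ∈ restrictSupport K B → f = 0
  exists_sub_mem : ∀ f, ∃ r ∈ restrictSupport K B, f - r ∈ J

lemma exists_isStandard [Finite σ] (J : Ideal (MvPolynomial σ K)) :
    ∃ B : Set (σ →₀ ℕ), IsLowerSet B ∧ IsStandard J B ∧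
      ∀ (e : σ →₀ ℕ), monomial e (1 : K) ∈ J → e ∉ B := by
  let _ : LinearOrder σ := LinearOrder.lift' (Finite.equivFin σ) (Finite.equivFin σ).injective
  let m : MonomialOrder σ := MonomialOrder.lex
  refine ⟨{c | ∀ f ∈ J, f ≠ 0 → ¬ m.degree f ≤ c}, fun c c' hc h f hf hf0 hle =>
    h f hf hf0 (hle.trans hc), ⟨fun f hf hB => ?_, fun f => ?_⟩, fun e he h => ?_⟩
  · by_contra hf0
    exact hB (m.degree_mem_support hf0) f hf hf0 le_rfl
  · obtain ⟨g, r, hfr, -, hr⟩ := m.div_set (B := {f | f ∈ J ∧ f ≠ 0})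
      (fun b hb => (m.leadingCoeff_ne_zero_iff.2 hb.2).isUnit) f
    refine ⟨r, fun c hc f hf hf0 => hr c hc f ⟨hf, hf0⟩, ?_⟩
    rw [hfr, add_sub_cancel_right, Finsupp.linearCombination_apply]
    exact Ideal.sum_mem _ fun b _ => Ideal.mul_mem_left _ _ b.2.1
  · classical
    refine h _ he (by simp) ?_
    rw [m.degree_monomial, if_neg one_ne_zero]

lemma weightedHomogeneousComponent_mem_restrictSupport (w : σ → κ → ℕ) {f : MvPolynomial σ K}
    {B : Set (σ →₀ ℕ)} (hf : f ∈ restrictSupport K B) (d : κ → ℕ) :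
    weightedHomogeneousComponent w d f ∈ restrictSupport K B := by
  classical
  rw [mem_restrictSupport_iff] at hf ⊢
  intro e he
  refine hf ?_
  rw [Finset.mem_coe, mem_support_iff] at he ⊢
  rw [coeff_weightedHomogeneousComponent] at he
  exact fun h => he (by simp [h])

lemma ghilb_eq_of_isStandard {w : σ → κ → ℕ} {J : Ideal (MvPolynomial σ K)}
    (hJ : HomogIdeal w J) {B : Set (σ →₀ ℕ)} (hB : IsStandard J B) (d : κ → ℕ) :
    ghilb w J d = Module.finrank K
      (weightedHomogeneousSubmodule K w d ⊓ restrictSupport K B : Submodule K _) := by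
  set V := weightedHomogeneousSubmodule K w d ⊓ restrictSupport K B
  have hmap : (weightedHomogeneousSubmodule K w d).map (Ideal.Quotient.mkₐ K J).toLinearMap =
      LinearMap.range ((Ideal.Quotient.mkₐ K J).toLinearMap.comp V.subtype) := by
    rw [LinearMap.range_comp, Submodule.range_subtype]
    refine le_antisymm ?_ (Submodule.map_mono inf_le_left)
    rintro _ ⟨f, hf, rfl⟩
    obtain ⟨r, hr, hfr⟩ := hB.exists_sub_mem f
    refine ⟨weightedHomogeneousComponent w d r,
      ⟨weightedHomogeneousComponent_isWeightedHomogeneous d r,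
        weightedHomogeneousComponent_mem_restrictSupport w hr d⟩, ?_⟩
    refine (Ideal.Quotient.eq.2 ?_).symm
    have := hJ _ hfr d
    rwa [map_sub, IsWeightedHomogeneous.weightedHomogeneousComponent_same hf] at this
  rw [ghilb, hmap]
  refine LinearMap.finrank_range_of_inj ((injective_iff_map_eq_zero _).2 ?_)
  rintro ⟨f, hf⟩ h
  exact Subtype.ext (hB.eq_zero f (Ideal.Quotient.eq_zero_iff_mem.1 h) hf.2)

lemma finite_of_X_pow_mem [Finite σ] {J : Ideal (MvPolynomial σ K)} {B : Set (σ →₀ ℕ)}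
    (hB : IsLowerSet B) (hJB : ∀ e, monomial e (1 : K) ∈ J → e ∉ B)
    (hJ : ∀ p, ∃ N : ℕ, (X p : MvPolynomial σ K) ^ N ∈ J) : B.Finite := by
  classical
  choose N hN using hJ
  refine (Set.finite_Icc 0 (Finsupp.equivFunOnFinite.symm N)).subset fun e he => ?_
  refine ⟨zero_le, Finsupp.le_def.2 ?_⟩
  intro p
  by_contra! hlt
  refine hJB (Finsupp.single p (N p)) ?_ (hB ?_ he)
  · rw [← X_pow_eq_monomial]
    exact hN p
  · rw [Finsupp.single_le_iff]
    exact hlt.le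

end Standard

/-! ### Lifting standard monomials to points -/

section Lift

variable {K : Type} [Field K] {k : ℕ} {n : Fin k → ℕ}

/-- The exponents of the variables `x_{i,j}` with `j ≥ 1`. -/
def restr (e : Sig k n →₀ ℕ) : SigS k n →₀ ℕ :=
  Finsupp.equivFunOnFinite.symm fun q => e ⟨q.1, q.2.succ⟩

@[simp] lemma restr_apply (e : Sig k n →₀ ℕ) (q : SigS k n) :
    restr e q = e ⟨q.1, q.2.succ⟩ := rfl

/-- The lifting coefficients: `l` for `x_{i,j}` with `j ≥ 1`, and `0` for `x_{i,0}`. -/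
def liftCoeff (K : Type) [Field K] (p : Sig k n) (l : ℕ) : K :=
  Fin.cases (motive := fun _ => K) 0 (fun _ => (l : K)) p.2

/-- The coordinates `[1 : b_{i,1} : ⋯ : b_{i,n_i}]` attached to `b`. -/
def coord (K : Type) [Field K] (b : SigS k n →₀ ℕ) (p : Sig k n) : K :=
  Fin.cases (motive := fun _ => K) 1 (fun j => (b ⟨p.1, j⟩ : K)) p.2

@[simp] lemma liftCoeff_zero (i : Fin k) (l : ℕ) :
    liftCoeff K (⟨i, 0⟩ : Sig k n) l = 0 := rfl

@[simp] lemma liftCoeff_succ (i : Fin k) (j : Fin (n i)) (l : ℕ) :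
    liftCoeff K (⟨i, j.succ⟩ : Sig k n) l = l := rfl

@[simp] lemma coord_zero (b : SigS k n →₀ ℕ) (i : Fin k) : coord K b ⟨i, 0⟩ = 1 := rfl

@[simp] lemma coord_succ (b : SigS k n →₀ ℕ) (i : Fin k) (j : Fin (n i)) :
    coord K b ⟨i, j.succ⟩ = b ⟨i, j⟩ := rfl

/-- The lift of a monomial: each power is replaced by a product of distinct linear forms. -/
def monLift (e : Sig k n →₀ ℕ) : MPRing K k n :=
  ∏ p, ∏ l ∈ Finset.range (e p), (X p - C (liftCoeff K p l) * X ⟨p.1, 0⟩)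

lemma monLift_zero : monLift (0 : Sig k n →₀ ℕ) = (1 : MPRing K k n) := by
  simp [monLift]

lemma monLift_add_single (e : Sig k n →₀ ℕ) (p : Sig k n) :
    monLift (e + Finsupp.single p 1) =
      (monLift e * (X p - C (liftCoeff K p (e p)) * X ⟨p.1, 0⟩) : MPRing K k n) := by
  classical
  rw [monLift, monLift, ← Finset.mul_prod_erase _ _ (Finset.mem_univ p),
    ← Finset.mul_prod_erase _ _ (Finset.mem_univ p)]
  have : ∏ q ∈ Finset.univ.erase p, ∏ l ∈ Finset.range ((e + Finsupp.single p 1 : Sig k n →₀ ℕ) q),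
      (X q - C (liftCoeff K q l) * X ⟨q.1, 0⟩ : MPRing K k n) =
      ∏ q ∈ Finset.univ.erase p, ∏ l ∈ Finset.range (e q),
      (X q - C (liftCoeff K q l) * X ⟨q.1, 0⟩) := by
    refine Finset.prod_congr rfl fun q hq => ?_
    rw [Finsupp.add_apply, Finsupp.single_eq_of_ne (Finset.ne_of_mem_erase hq), add_zero]
  rw [this, Finsupp.add_apply, Finsupp.single_eq_same, Finset.prod_range_succ]
  ring

/-- The linear automorphism of `R` sending each monomial to its lift. -/
def polyLift : MPRing K k n →ₗ[K] MPRing K k n :=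
  (basisMonomials (Sig k n) K).constr K monLift

lemma polyLift_monomial (e : Sig k n →₀ ℕ) (c : K) :
    polyLift (monomial e c : MPRing K k n) = c • monLift e := by
  have h : (monomial e c : MPRing K k n) = c • basisMonomials (Sig k n) K e := by
    simp [smul_monomial]
  rw [h, map_smul, polyLift, Module.Basis.constr_basis]

lemma polyLift_eq_sum (g : MPRing K k n) : polyLift g = ∑ e ∈ g.support, g.coeff e • monLift e := by
  conv_lhs => rw [g.as_sum, map_sum]
  exact Finset.sum_congr rfl fun e _ => polyLift_monomial e _

lemma polyLift_mem {g : MPRing K k n} {I : Ideal (MPRing K k n)}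
    (h : ∀ e ∈ g.support, monLift e ∈ I) : polyLift g ∈ I := by
  rw [polyLift_eq_sum]
  exact Submodule.sum_mem _ fun e he => Submodule.smul_of_tower_mem I _ (h e he)

lemma polyLift_X_mul (i : Fin k) (g : MPRing K k n) :
    polyLift (X ⟨i, 0⟩ * g) = X ⟨i, 0⟩ * polyLift g := by
  induction g using MvPolynomial.induction_on' with
  | monomial e c =>
    rw [show X ⟨i, 0⟩ * monomial e c = monomial (e + Finsupp.single (⟨i, 0⟩ : Sig k n) 1) c by
      rw [monomial_add_single, pow_one, mul_comm], polyLift_monomial, polyLift_monomial,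
      monLift_add_single]
    simp [mul_comm]
  | add p q hp hq => simp only [mul_add, map_add, hp, hq]

lemma polyLift_surjective : Function.Surjective (polyLift : MPRing K k n → MPRing K k n) := by
  intro f
  rw [← LinearMap.mem_range]
  induction f using MvPolynomial.induction_on with
  | C c => exact ⟨monomial 0 c, by rw [polyLift_monomial, monLift_zero, smul_eq_C_mul, mul_one]⟩
  | add p q hp hq => exact add_mem hp hq
  | mul_X p q hp =>
    obtain ⟨g, rfl⟩ := hp
    induction g using MvPolynomial.induction_on' with
    | monomial e c =>
      refine ⟨monomial (e + Finsupp.single q 1) c +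
        X ⟨q.1, 0⟩ * monomial e (c * liftCoeff K q (e q)), ?_⟩
      rw [map_add, polyLift_X_mul, polyLift_monomial, polyLift_monomial,
        polyLift_monomial, monLift_add_single]
      simp only [smul_eq_C_mul, map_mul]
      ring
    | add p q hp hq => rw [map_add, add_mul]; exact add_mem hp hq

/-- Restriction of polynomials to the cone over the point attached to `b`. -/
def evalCone (b : SigS k n →₀ ℕ) : MPRing K k n →ₐ[K] MvPolynomial (Fin k) K :=
  aeval fun p => C (coord K b p) * X p.1

lemma eval_evalCone (b : SigS k n →₀ ℕ) (t : Fin k → K) (f : MPRing K k n) :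
    eval t (evalCone b f) = eval (fun p => t p.1 * coord K b p) f := by
  induction f using MvPolynomial.induction_on with
  | C c => simp [MvPolynomial.algHom_C, MvPolynomial.algebraMap_eq]
  | add p q hp hq => simp only [map_add, hp, hq]
  | mul_X p q hp =>
    rw [map_mul, map_mul, map_mul, hp, evalCone, aeval_X]
    simp [mul_comm]

/-- The multidegree of a monomial, as an exponent vector. -/
def multideg (e : Sig k n →₀ ℕ) : Fin k →₀ ℕ :=
  Finsupp.equivFunOnFinite.symm fun i => ∑ j, e ⟨i, j⟩

/-- The value of the lift of a monomial on the cone over the point attached to `b`. -/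
def liftValue (K : Type) [Field K] (b : SigS k n →₀ ℕ) (e : Sig k n →₀ ℕ) : K :=
  ∏ p, ∏ l ∈ Finset.range (e p), (coord K b p - liftCoeff K p l)

lemma evalCone_monLift (b : SigS k n →₀ ℕ) (e : Sig k n →₀ ℕ) :
    evalCone b (monLift e : MPRing K k n) = monomial (multideg e) (liftValue K b e) := by
  have h1 : (monomial (multideg e) (1 : K)) = ∏ p : Sig k n, X p.1 ^ e p := by
    rw [← prod_X_pow_eq_monomial, Finset.prod_subset (Finset.subset_univ _), Fintype.prod_sigma]
    · refine Finset.prod_congr rfl fun i _ => ?_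
      exact (Finset.prod_pow_eq_pow_sum Finset.univ (fun j => e ⟨i, j⟩) (X i)).symm
    · intro i _ hi
      rw [Finsupp.notMem_support_iff.1 hi, pow_zero]
  rw [← mul_one (liftValue K b e), ← C_mul_monomial, h1, liftValue, monLift, map_prod, map_prod,
    ← Finset.prod_mul_distrib]
  refine Finset.prod_congr rfl fun p _ => ?_
  rw [map_prod, map_prod]
  have h2 : (X p.1 : MvPolynomial (Fin k) K) ^ e p = ∏ _l ∈ Finset.range (e p), X p.1 := by
    rw [Finset.prod_const, Finset.card_range]
  rw [h2, ← Finset.prod_mul_distrib]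
  refine Finset.prod_congr rfl fun l _ => ?_
  simp [evalCone, MvPolynomial.algHom_C, MvPolynomial.algebraMap_eq]
  ring

lemma liftValue_eq_zero {b : SigS k n →₀ ℕ} {e : Sig k n →₀ ℕ} (h : ¬ restr e ≤ b) :
    liftValue K b e = 0 := by
  rw [Finsupp.le_def] at h
  push Not at h
  obtain ⟨⟨i, j⟩, hq⟩ := h
  refine Finset.prod_eq_zero (Finset.mem_univ ⟨i, j.succ⟩) ?_
  exact Finset.prod_eq_zero (Finset.mem_range.2 hq) (by simp)

lemma liftValue_restr_ne_zero [CharZero K] (e : Sig k n →₀ ℕ) :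
    liftValue K (restr e) e ≠ 0 := by
  refine Finset.prod_ne_zero_iff.2 fun ⟨i, j⟩ _ => Finset.prod_ne_zero_iff.2 fun l hl => ?_
  rw [Finset.mem_range] at hl
  refine Fin.cases (fun _ => by simp) (fun j hl => ?_) j hl
  rw [coord_succ, liftCoeff_succ, sub_ne_zero, restr_apply]
  exact_mod_cast hl.ne'

lemma eq_of_restr_eq {e e' : Sig k n →₀ ℕ} (h : restr e = restr e')
    (h' : multideg e = multideg e') : e = e' := by
  have hs : ∀ i (j : Fin (n i)), e ⟨i, j.succ⟩ = e' ⟨i, j.succ⟩ := fun i j =>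
    DFunLike.congr_fun h ⟨i, j⟩
  ext ⟨i, j⟩
  refine Fin.cases ?_ (hs i) j
  have : ∑ j, e ⟨i, j⟩ = ∑ j, e' ⟨i, j⟩ := DFunLike.congr_fun h' i
  rw [Fin.sum_univ_succ, Fin.sum_univ_succ, Finset.sum_congr rfl fun j _ => hs i j] at this
  omega

lemma exists_evalCone_polyLift_ne_zero [CharZero K] {g : MPRing K k n} (hg : g ≠ 0) :
    ∃ e ∈ g.support, evalCone (restr e) (polyLift g) ≠ 0 := by
  obtain ⟨e, he⟩ := g.support.exists_minimalFor restr (support_nonempty.2 hg)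
  refine ⟨e, he.1, fun h0 => ?_⟩
  have h1 := congrArg (coeff (multideg e)) h0
  rw [polyLift_eq_sum, map_sum, coeff_sum, Finset.sum_eq_single_of_mem e he.1] at h1
  · rw [map_smul, evalCone_monLift, coeff_smul, coeff_monomial, if_pos rfl] at h1
    exact mul_ne_zero (mem_support_iff.1 he.1) (liftValue_restr_ne_zero e) h1
  · intro e' he' hne
    rw [map_smul, evalCone_monLift, coeff_smul, coeff_monomial]
    split_ifs with hd
    · rw [liftValue_eq_zero, smul_zero]
      intro hle
      exact hne (eq_of_restr_eq (le_antisymm hle (he.2 he' hle)) hd)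
    · exact smul_zero _

lemma polyLift_injective [CharZero K] :
    Function.Injective (polyLift : MPRing K k n →ₗ[K] MPRing K k n) := by
  refine (injective_iff_map_eq_zero _).2 fun g hg => ?_
  by_contra h
  obtain ⟨e, -, he⟩ := exists_evalCone_polyLift_ne_zero h
  exact he (by rw [hg, map_zero])

/-- The coefficients of the linear forms `x_{i,0}`. -/
def zeroCoeff (K : Type) [Field K] (p : Sig k n) : K :=
  Fin.cases (motive := fun _ => K) 1 (fun _ => 0) p.2

lemma linForm_zeroCoeff : linForm (zeroCoeff K (n := n)) = fun i => X ⟨i, 0⟩ := by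
  funext i
  simp [linForm, Fin.sum_univ_succ, zeroCoeff]

lemma elim_monLift (e : Sig k n →₀ ℕ) :
    elim (zeroCoeff K) (monLift e) = C (∏ i, 0 ^ e ⟨i, 0⟩) * monomial (restr e) 1 := by
  have h1 : ∀ p : Sig k n, ∀ l, elim (zeroCoeff K) (X p - C (liftCoeff K p l) * X ⟨p.1, 0⟩) =
      elim (zeroCoeff K) (X p) := by
    intro p l
    rw [map_sub, map_mul, elim_X_zero]
    simp [zeroCoeff]
  have h2 : (monomial (restr e) (1 : K)) = ∏ q, X q ^ e ⟨q.1, q.2.succ⟩ := by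
    rw [← prod_X_pow_eq_monomial, Finset.prod_subset (Finset.subset_univ _)]
    · rfl
    · intro q _ hq
      rw [Finsupp.notMem_support_iff.1 hq, pow_zero]
  rw [h2, monLift, map_prod, Fintype.prod_sigma, Fintype.prod_sigma, map_prod,
    ← Finset.prod_mul_distrib]
  refine Finset.prod_congr rfl fun i _ => ?_
  rw [Fin.prod_univ_succ]
  simp only [map_prod, h1, Finset.prod_const, Finset.card_range, elim_X_zero, elim_X_succ]
  simp [zeroCoeff]

end Lift

/-! ### The points attached to a lower set of monomials -/

section MonPoints

variable {K : Type} [Field K] [CharZero K] {k : ℕ} {n : Fin k → ℕ}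

lemma exists_rep_monToPoint (b : SigS k n →₀ ℕ) (i : Fin k) :
    ∃ c : K, c ≠ 0 ∧ ∀ j, (monToPoint K k n b i).rep j = c * coord K b ⟨i, j⟩ := by
  obtain ⟨c, hc⟩ := Projectivization.exists_smul_eq_mk_rep K
    (fun j : Fin (n i + 1) => if h : j = 0 then (1 : K) else ((b ⟨i, j.pred h⟩ : ℕ) : K))
    (fun h => by simpa using congrFun h 0)
  refine ⟨c, c.ne_zero, fun j => ?_⟩
  rw [monToPoint, ← hc, Pi.smul_apply, Units.smul_def, smul_eq_mul]
  refine Fin.cases ?_ (fun j => ?_) j <;> simp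

lemma mem_cone_monToPoint {b : SigS k n →₀ ℕ} {x : Sig k n → K} :
    x ∈ cone K k n (monToPoint K k n b) ↔ ∃ t : Fin k → K, x = fun p => t p.1 * coord K b p := by
  choose c hc0 hc using exists_rep_monToPoint (K := K) b
  constructor
  · intro h
    choose t ht using h
    refine ⟨fun i => t i * c i, funext fun p => ?_⟩
    refine (congrFun (ht p.1) p.2).trans ?_
    rw [Pi.smul_apply, hc, smul_eq_mul, mul_assoc]
  · rintro ⟨t, rfl⟩ i
    refine ⟨t i / c i, funext fun j => ?_⟩
    rw [Pi.smul_apply, hc, smul_eq_mul]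
    field_simp [hc0 i]

lemma mem_idealOfSet_monToPoint {B : Set (SigS k n →₀ ℕ)} {f : MPRing K k n} :
    f ∈ idealOfSet K k n (monToPoint K k n '' B) ↔ ∀ b ∈ B, evalCone b f = 0 := by
  rw [mem_idealOfSet, Set.forall_mem_image]
  refine forall₂_congr fun b _ => ?_
  constructor
  · intro h
    refine MvPolynomial.funext fun t => ?_
    rw [eval_evalCone, map_zero]
    exact h _ (mem_cone_monToPoint.2 ⟨t, rfl⟩)
  · intro h x hx
    obtain ⟨t, rfl⟩ := mem_cone_monToPoint.1 hx
    rw [← eval_evalCone, h, map_zero]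

/-- The exponents outside `B`, or involving `x_{j,0}` for some `j ∈ s`. -/
def offExponents (B : Set (SigS k n →₀ ℕ)) (s : Finset (Fin k)) : Set (Sig k n →₀ ℕ) :=
  {e | restr e ∉ B ∨ ∃ j ∈ s, e ⟨j, 0⟩ ≠ 0}

lemma monLift_mem_idealOfSet {B : Set (SigS k n →₀ ℕ)} (hB : IsLowerSet B)
    {e : Sig k n →₀ ℕ} (he : restr e ∉ B) :
    monLift e ∈ idealOfSet K k n (monToPoint K k n '' B) := by
  rw [mem_idealOfSet_monToPoint]
  intro b hb
  rw [evalCone_monLift, liftValue_eq_zero fun h => he (hB h hb), map_zero]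

lemma mem_restrictSupport_of_polyLift_mem {B : Set (SigS k n →₀ ℕ)}
    (hB : IsLowerSet B) {g : MPRing K k n}
    (hg : polyLift g ∈ idealOfSet K k n (monToPoint K k n '' B)) :
    g ∈ restrictSupport K (offExponents B ∅) := by
  classical
  set g₁ : MPRing K k n := ∑ e ∈ g.support with restr e ∉ B, monomial e (g.coeff e) with hg₁
  have hc : ∀ e, coeff e g₁ = if restr e ∉ B then coeff e g else 0 := by
    intro e
    simp only [hg₁, coeff_sum, coeff_monomial, Finset.sum_ite_eq', Finset.mem_filter,
      mem_support_iff]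
    by_cases h : coeff e g = 0 <;> simp [h]
  have h₁ : polyLift g₁ ∈ idealOfSet K k n (monToPoint K k n '' B) := by
    refine polyLift_mem fun e he => monLift_mem_idealOfSet hB fun heB => ?_
    rw [mem_support_iff, hc, if_neg (not_not.2 heB)] at he
    exact he rfl
  have h₂ : g - g₁ = 0 := by
    by_contra h
    obtain ⟨e, he, hne⟩ := exists_evalCone_polyLift_ne_zero h
    rw [mem_support_iff, coeff_sub, hc] at he
    have heB : restr e ∈ B := by
      by_contra heB
      simp [heB] at he
    refine hne (mem_idealOfSet_monToPoint.1 ?_ _ heB)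
    rw [map_sub]
    exact sub_mem hg h₁
  rw [mem_restrictSupport_iff, sub_eq_zero.1 h₂]
  intro e he
  rw [Finset.mem_coe, mem_support_iff, hc] at he
  by_contra h
  exact he (if_neg fun h' => h (Or.inl h'))

lemma mem_sup_span_X_iff {B : Set (SigS k n →₀ ℕ)} (hB : IsLowerSet B)
    (s : Finset (Fin k)) {g : MPRing K k n} :
    polyLift g ∈ idealOfSet K k n (monToPoint K k n '' B) ⊔
        Ideal.span ((fun i => (X ⟨i, 0⟩ : MPRing K k n)) '' s) ↔
      g ∈ restrictSupport K (offExponents B s) := by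
  set I := idealOfSet K k n (monToPoint K k n '' B)
  constructor
  · intro h
    obtain ⟨f, hf, r, hr, hfr⟩ := Submodule.mem_sup.1 h
    have hspan : ∀ r ∈ Ideal.span ((fun i => (X ⟨i, 0⟩ : MPRing K k n)) '' s),
        r ∈ (restrictSupport K (offExponents B s)).map polyLift := by
      intro r hr
      suffices h : ∀ f, f * r ∈ (restrictSupport K (offExponents B s)).map polyLift by
        simpa using h 1
      induction hr using Submodule.span_induction with
      | mem x hx =>
        obtain ⟨i, hi, rfl⟩ := hx
        intro f
        obtain ⟨g, rfl⟩ := polyLift_surjective f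
        refine ⟨X ⟨i, 0⟩ * g, (mem_restrictSupport_iff K).2 fun e he =>
          Or.inr ⟨i, hi, fun h0 => ?_⟩, ?_⟩
        · classical
          rw [Finset.mem_coe, mem_support_iff, coeff_X_mul'] at he
          simp [h0] at he
        · rw [polyLift_X_mul, mul_comm]
      | zero => simp
      | add x y _ _ hx hy =>
        intro f
        rw [mul_add]
        exact add_mem (hx f) (hy f)
      | smul a x _ hx =>
        intro f
        rw [smul_eq_mul, ← mul_assoc]
        exact hx _
    obtain ⟨f, rfl⟩ := polyLift_surjective f
    obtain ⟨r, hr', rfl⟩ := hspan r hr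
    rw [← map_add] at hfr
    rw [← polyLift_injective hfr]
    refine add_mem (restrictSupport_mono _ ?_ (mem_restrictSupport_of_polyLift_mem hB hf)) hr'
    rintro e (he | ⟨j, hj, -⟩)
    · exact Or.inl he
    · simp at hj
  · intro h
    refine polyLift_mem fun e he => ?_
    obtain he | ⟨j, hj, hej⟩ := h he
    · exact Ideal.mem_sup_left (monLift_mem_idealOfSet hB he)
    · refine Ideal.mem_sup_right ?_
      have : e = e - Finsupp.single ⟨j, 0⟩ 1 + Finsupp.single ⟨j, 0⟩ 1 :=
        (tsub_add_cancel_of_le (Finsupp.single_le_iff.2 (Nat.one_le_iff_ne_zero.2 hej))).symm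
      rw [this, monLift_add_single, liftCoeff_zero, map_zero, zero_mul, sub_zero]
      exact Ideal.mul_mem_left _ _ (Ideal.subset_span ⟨j, hj, rfl⟩)

lemma nonZeroDivMod_linForm_zeroCoeff {B : Set (SigS k n →₀ ℕ)} (hB : IsLowerSet B)
    (s : Finset (Fin k)) (i : Fin k) (hi : i ∉ s) :
    NonZeroDivMod (idealOfSet K k n (monToPoint K k n '' B) ⊔
      Ideal.span (linForm (zeroCoeff K) '' s)) (linForm (zeroCoeff K) i) := by
  rw [linForm_zeroCoeff]
  intro f hf
  obtain ⟨g, rfl⟩ := polyLift_surjective f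
  rw [← polyLift_X_mul, mem_sup_span_X_iff hB, mem_restrictSupport_iff] at hf
  rw [mem_sup_span_X_iff hB, mem_restrictSupport_iff]
  intro e he
  have he' : e + Finsupp.single ⟨i, 0⟩ 1 ∈ (X (⟨i, 0⟩ : Sig k n) * g).support := by
    rw [mem_support_iff, add_comm, coeff_X_mul]
    exact mem_support_iff.1 he
  obtain h | ⟨j, hj, hne⟩ := hf he'
  · refine Or.inl ?_
    have hr : restr (e + Finsupp.single ⟨i, 0⟩ 1) = restr e := by
      ext q
      have hq : (⟨q.1, q.2.succ⟩ : Sig k n) ≠ ⟨i, 0⟩ := by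
        rintro h
        obtain ⟨rfl, h⟩ := Sigma.mk.inj_iff.1 h
        exact Fin.succ_ne_zero _ (eq_of_heq h)
      rw [restr_apply, Finsupp.add_apply, Finsupp.single_eq_of_ne hq, add_zero, restr_apply]
    exact hr ▸ h
  · refine Or.inr ⟨j, hj, ?_⟩
    have hij : i ≠ j := fun h => hi (h ▸ hj)
    simpa [Finsupp.single_apply, hij] using hne

lemma sum_zeroCoeff_rep_ne_zero {B : Set (SigS k n →₀ ℕ)} :
    ∀ P ∈ monToPoint K k n '' B, ∀ i, ∑ j, zeroCoeff K ⟨i, j⟩ * (P i).rep j ≠ 0 := by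
  rintro _ ⟨b, -, rfl⟩ i
  obtain ⟨c, hc0, hc⟩ := exists_rep_monToPoint (K := K) b i
  simpa [Fin.sum_univ_succ, zeroCoeff, hc] using hc0

lemma isStandard_map_elim {B : Set (SigS k n →₀ ℕ)} (hB : IsLowerSet B) :
    IsStandard ((idealOfSet K k n (monToPoint K k n '' B)).map (elim (zeroCoeff K))) B := by
  constructor
  · intro f hf hfB
    obtain ⟨h, hh, rfl⟩ := (Ideal.mem_map_iff_of_surjective _ (elim_surjective _)).1 hf
    obtain ⟨g, rfl⟩ := polyLift_surjective h
    have hg := mem_restrictSupport_of_polyLift_mem hB hh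
    have hc : elim (zeroCoeff K) (polyLift g) ∈ restrictSupport K Bᶜ := by
      rw [polyLift_eq_sum, map_sum]
      refine Submodule.sum_mem _ fun e he => ?_
      rw [map_smul, elim_monLift, C_mul_monomial]
      refine Submodule.smul_mem _ _ ((monomial_mem_restrictSupport K).2 (Or.inl ?_))
      obtain h | ⟨j, hj, -⟩ := hg he
      · exact h
      · simp at hj
    rw [mem_restrictSupport_iff] at hc hfB
    rw [← support_eq_empty, Finset.eq_empty_iff_forall_notMem]
    exact fun e he => hc he (hfB he)
  · intro f
    induction f using MvPolynomial.induction_on' with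
    | monomial b c =>
      by_cases hb : b ∈ B
      · exact ⟨monomial b c, (monomial_mem_restrictSupport K).2 (Or.inl hb), by simp⟩
      · refine ⟨0, zero_mem _, ?_⟩
        let e : Sig k n →₀ ℕ := Finsupp.equivFunOnFinite.symm fun p =>
          Fin.cases (motive := fun _ => ℕ) 0 (fun j => b ⟨p.1, j⟩) p.2
        have he : restr e = b := by
          ext q
          rfl
        have h0 : ∀ i, e ⟨i, 0⟩ = 0 := fun i => rfl
        have := Ideal.mem_map_of_mem (elim (zeroCoeff K))
          (monLift_mem_idealOfSet (K := K) hB (he ▸ hb : restr e ∉ B))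
        rw [elim_monLift, he] at this
        simp only [h0, pow_zero, Finset.prod_const_one, map_one, one_mul] at this
        rw [sub_zero, ← mul_one c, ← C_mul_monomial]
        exact Ideal.mul_mem_left _ _ this
    | add p q hp hq =>
      obtain ⟨r, hr, hpr⟩ := hp
      obtain ⟨t, ht, hqt⟩ := hq
      refine ⟨r + t, add_mem hr ht, ?_⟩
      rw [add_sub_add_comm]
      exact add_mem hpr hqt

lemma exists_isACM_of_artinian {J : Ideal (SRing K k n)} (hJ : IsHomogIdealS K k n J)
    (hart : IsArtinianIdealS K k n J) :
    ∃ X : Set (MPPoint K k n), X.Finite ∧ IsACM K k n X ∧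
      ∀ d, (hilbS K k n J d : ℤ) = delta k (hilb K k n (idealOfSet K k n X)) d := by
  obtain ⟨B, hB, hstd, hJB⟩ := exists_isStandard J
  have hfin : B.Finite := finite_of_X_pow_mem hB hJB fun p => by
    have : (X p : SRing K k n) ∈ J.radical := by
      rw [hart]
      exact Ideal.subset_span ⟨p, rfl⟩
    exact this
  have hne : B.Nonempty := by
    rw [Set.nonempty_iff_ne_empty]
    rintro rfl
    have h1 : (1 : SRing K k n) ∈ J := by
      obtain ⟨r, hr, h⟩ := hstd.exists_sub_mem 1
      have : r = 0 := by
        rw [mem_restrictSupport_iff, Set.subset_empty_iff, Finset.coe_eq_empty] at hr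
        exact support_eq_empty.1 hr
      simpa [this] using h
    refine (isPrime_span_range_X (K := K) (σ := SigS k n)).ne_top ?_
    rw [← hart, (Ideal.eq_top_iff_one J).2 h1, Ideal.radical_top]
  have hXfin := hfin.image (monToPoint K k n)
  refine ⟨monToPoint K k n '' B, hXfin, isACM_of_nonZeroDivMod hXfin (hne.image _)
    sum_zeroCoeff_rep_ne_zero (nonZeroDivMod_linForm_zeroCoeff hB), fun d => ?_⟩
  rw [← hilbS_map_elim _ (fun _ => rfl) (nonZeroDivMod_linForm_zeroCoeff hB) d]
  refine congrArg Nat.cast ((ghilb_eq_of_isStandard hJ hstd d).trans ?_)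
  exact (ghilb_eq_of_isStandard (homogIdeal_map_elim _ (homogIdeal_idealOfSet _))
    (isStandard_map_elim hB) d).symm

end MonPoints

/-- `H` is the Hilbert function of an ACM set of distinct points of
`ℙ^{n_1} × ⋯ × ℙ^{n_k}` iff `ΔH` is the Hilbert function of an `ℕ^k`-graded artinian
quotient of `S = k[x_{1,1},…,x_{k,n_k}]`. -/
theorem statement_7 (K : Type) [Field K] [IsAlgClosed K] [CharZero K]
    (k : ℕ) (n : Fin k → ℕ) (H : (Fin k → ℕ) → ℕ) :
    (∃ X : Set (MPPoint K k n), X.Finite ∧ IsACM K k n X ∧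
        ∀ d : Fin k → ℕ, hilb K k n (idealOfSet K k n X) d = H d) ↔
    (∃ J : Ideal (SRing K k n), IsHomogIdealS K k n J ∧ IsArtinianIdealS K k n J ∧
        ∀ d : Fin k → ℕ, (hilbS K k n J d : ℤ) = delta k H d) := by
  constructor
  · rintro ⟨X, hX, hACM, hH⟩
    obtain rfl := funext hH
    exact exists_artinian_of_isACM hX hACM
  · rintro ⟨J, hJ, hart, hH⟩
    obtain ⟨X, hX, hACM, hXJ⟩ := exists_isACM_of_artinian hJ hart
    exact ⟨X, hX, hACM, congrFun (delta_injective fun d => (hXJ d).symm.trans (hH d))⟩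

end PaperMP
end
end

section
/- Let S = 𝕜[x_1,…,x_k] with deg x_i = e_i (the i-th standard basis vector of ℕ^k), and let H : ℕ^k → ℕ be a numerical function. Then there exists an ℕ^k-homogeneous ideal I ⊊ S with Hilbert function H_{S/I} = H if and only if: (i) H(0,…,0) = 1; (ii) H(i) ∈ {0,1} for all i > (0,…,0); and (iii) if H(i) = 0 then H(j) = 0 for all j ≥ i (coordinatewise). -/
open MvPolynomial

noncomputable section

namespace PaperMP

theorem weight_wtT (k : ℕ) (e : Fin k →₀ ℕ) : Finsupp.weight (wtT k) e = e := by
  ext i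
  simp [Finsupp.weight_apply, Finsupp.sum_fintype, wtT, Finset.sum_apply, Pi.single_apply]

theorem weightedHomogeneousSubmodule_wtT (K : Type) [Field K] (k : ℕ) (d : Fin k → ℕ) :
    weightedHomogeneousSubmodule K (wtT k) d =
      Submodule.span K {(monomial (Finsupp.equivFunOnFinite.symm d) 1 : TRing K k)} := by
  ext f
  rw [mem_weightedHomogeneousSubmodule, Submodule.mem_span_singleton]
  constructor
  · intro hf
    refine ⟨coeff (Finsupp.equivFunOnFinite.symm d) f, ?_⟩
    ext e
    rw [smul_monomial, smul_eq_mul, mul_one, coeff_monomial]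
    split_ifs with h
    · rw [h]
    · by_contra hne
      apply h
      have := hf (Ne.symm hne)
      rw [weight_wtT] at this
      rw [← this]
      exact Finsupp.equivFunOnFinite.symm_apply_apply e
  · rintro ⟨c, rfl⟩
    rw [smul_monomial]
    apply isWeightedHomogeneous_monomial
    rw [weight_wtT]
    rfl

open Classical in
/-- Graded pieces of `S` are lines spanned by monomials, so the Hilbert function of `S/I`
detects exactly which monomials lie in `I`. -/
theorem hilbT_eq_ite (K : Type) [Field K] (k : ℕ) (I : Ideal (TRing K k)) (d : Fin k → ℕ) :
    hilbT K k I d =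
      if (monomial (Finsupp.equivFunOnFinite.symm d) 1 : TRing K k) ∈ I then 0 else 1 := by
  rw [hilbT, weightedHomogeneousSubmodule_wtT, Submodule.map_span, Set.image_singleton]
  split_ifs with h
  · have h0 : (Ideal.Quotient.mkₐ K I).toLinearMap
        (monomial (Finsupp.equivFunOnFinite.symm d) 1) = 0 :=
      Ideal.Quotient.eq_zero_iff_mem.mpr h
    rw [h0]
    simp
  · exact finrank_span_singleton fun h0 => h (Ideal.Quotient.eq_zero_iff_mem.mp h0)

theorem monomial_mem_of_le_s8 {K : Type} [Field K] {k : ℕ} {I : Ideal (TRing K k)}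
    {d e : Fin k →₀ ℕ} (h : d ≤ e) (hd : (monomial d 1 : TRing K k) ∈ I) :
    (monomial e 1 : TRing K k) ∈ I := by
  have := I.mul_mem_left (monomial (e - d) 1) hd
  rwa [monomial_mul, tsub_add_cancel_of_le h, one_mul] at this

theorem isHomogIdealT_span_monomial (K : Type) [Field K] (k : ℕ) (s : Set (Fin k →₀ ℕ)) :
    IsHomogIdealT K k (Ideal.span ((fun e => monomial e (1 : K)) '' s)) := by
  classical
  intro f hf d
  rw [mem_ideal_span_monomial_image] at hf ⊢
  intro e he
  apply hf e
  rw [mem_support_iff, coeff_weightedHomogeneousComponent] at he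
  rw [mem_support_iff]
  split_ifs at he with h
  · exact he
  · exact absurd rfl he

/-- characterization of the Hilbert functions of `ℕ^k`-graded quotients
of `S = k[x_1,…,x_k]` with `deg x_i = e_i`. -/
theorem statement_8 (K : Type) [Field K] [IsAlgClosed K] [CharZero K]
    (k : ℕ) (H : (Fin k → ℕ) → ℕ) :
    (∃ I : Ideal (TRing K k), IsHomogIdealT K k I ∧ I ≠ ⊤ ∧
        ∀ d : Fin k → ℕ, hilbT K k I d = H d) ↔
    (H 0 = 1 ∧
      (∀ d : Fin k → ℕ, d ≠ 0 → H d = 0 ∨ H d = 1) ∧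
      (∀ d : Fin k → ℕ, H d = 0 → ∀ j : Fin k → ℕ, d ≤ j → H j = 0)) := by
  constructor
  · rintro ⟨I, -, hI, hH⟩
    simp only [hilbT_eq_ite] at hH
    refine ⟨?_, fun d _ => ?_, fun d hd j hj => ?_⟩
    · rw [← hH, if_neg]
      intro h
      have hzero : Finsupp.equivFunOnFinite.symm (0 : Fin k → ℕ) = 0 := by ext; rfl
      rw [hzero] at h
      exact hI ((Ideal.eq_top_iff_one I).mpr h)
    · rw [← hH]
      split_ifs <;> simp
    · rw [← hH] at hd ⊢
      have hmem := by simpa using hd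
      exact if_pos (monomial_mem_of_le_s8 (fun i => hj i) hmem)
  · rintro ⟨h0, h1, h2⟩
    have key : ∀ d : Fin k → ℕ, (monomial (Finsupp.equivFunOnFinite.symm d) 1 : TRing K k) ∈
        Ideal.span ((fun e => monomial e (1 : K)) '' {e : Fin k →₀ ℕ | H e = 0}) ↔ H d = 0 := by
      intro d
      classical
      rw [mem_ideal_span_monomial_image]
      constructor
      · intro h
        obtain ⟨e, he, hle⟩ := h (Finsupp.equivFunOnFinite.symm d) (by simp)
        exact h2 _ he _ hle
      · intro h e he
        have hed : e = Finsupp.equivFunOnFinite.symm d := by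
          simpa using support_monomial_subset he
        exact ⟨_, h, hed.ge⟩
    refine ⟨_, isHomogIdealT_span_monomial K k {e | H e = 0}, fun htop => ?_, fun d => ?_⟩
    · have := (key 0).mp (htop ▸ Submodule.mem_top)
      omega
    · rw [hilbT_eq_ite]
      simp only [key]
      split_ifs with h
      · exact h.symm
      · rcases eq_or_ne d 0 with rfl | hd
        · exact h0.symm
        · exact ((h1 d hd).resolve_left h).symm

end PaperMP
end
end
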